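/- Let N ≥ 1 and let d₁, …, d_N be non-negative integers, not all zero. Set L = ⨁_{n=1}^{N} ℂ^{d_n} with ℂ* acting on the n-th summand by λ·v = λ^{−n}v, and R = ⨁_{n=1}^{N} ℂ^{d_n} with ℂ* acting on the n-th summand by λ·v = λ^{n}v; let ℂ* act diagonally on L ⊕ R. Let U = {(x, y) ∈ L ⊕ R : x ≠ 0 and y ≠ 0}, an invariant open subset, and let M = dim_ℂ L − 1. Then the orbit space U/ℂ* has nontrivial rational singular homology in every dimension belonging to {0, 2, 4, …, 2M} ∪ {2M+1, 2M+3, …, 4M+1}. In particular, U/ℂ* does not have the rational homology of any sphere unless M = 0 (i.e., unless dim_ℂ L = dim_ℂ R = 1). -/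

import Mathlib

open CategoryTheory

noncomputable def ratHomology (X : Type) [TopologicalSpace X] (n : ℕ) : ModuleCat ℚ :=
  ((AlgebraicTopology.alternatingFaceMapComplex (ModuleCat ℚ)).obj
    (((SimplicialObject.whiskering _ _).obj (ModuleCat.free ℚ)).obj
      (TopCat.toSSet.obj (TopCat.of X)))).homology n

def SphereSpace (m : ℤ) : Type :=
  if 0 ≤ m then Metric.sphere (0 : EuclideanSpace ℝ (Fin (m.toNat + 1))) 1 else Empty

noncomputable instance (m : ℤ) : TopologicalSpace (SphereSpace m) := by
  unfold SphereSpace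
  split <;> infer_instance

def actionSetoid {G X : Type*} [Group G] (φ : G →* Function.End X) : Setoid X where
  r v w := ∃ g : G, φ g v = w
  iseqv := by
    constructor
    · intro v
      exact ⟨1, by rw [map_one]; rfl⟩
    · rintro v w ⟨g, rfl⟩
      refine ⟨g⁻¹, ?_⟩
      have h : φ g⁻¹ * φ g = 1 := by rw [← map_mul, inv_mul_cancel, map_one]
      calc φ g⁻¹ (φ g v) = (φ g⁻¹ * φ g) v := rfl
      _ = v := by rw [h]; rfl
    · rintro u v w ⟨g, rfl⟩ ⟨g', rfl⟩
      refine ⟨g' * g, ?_⟩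
      calc φ (g' * g) u = (φ g' * φ g) u := by rw [map_mul]
      _ = φ g' (φ g u) := rfl

/-- The diagonal `ℂ*`-action on `L ⊕ R`, acting with weight `−n` on the `n`-th summand
`ℂ^{d_n}` of `L` and weight `n` on the `n`-th summand of `R` (summands indexed by
`n ∈ {1, …, N}`, here `n = (⟨n⟩ : Fin N) + 1`). -/
def diagWeightHom (N : ℕ) (d : Fin N → ℕ) :
    ℂˣ →* Function.End ((∀ n : Fin N, Fin (d n) → ℂ) × (∀ n : Fin N, Fin (d n) → ℂ)) where
  toFun t := fun p =>
    (fun n i => ((t ^ (-((n : ℕ) + 1) : ℤ) : ℂˣ) : ℂ) * p.1 n i,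
     fun n i => ((t ^ (((n : ℕ) + 1 : ℕ) : ℤ) : ℂˣ) : ℂ) * p.2 n i)
  map_one' := by
    funext p
    refine Prod.ext ?_ ?_ <;> funext n i
    · show (((1 : ℂˣ) ^ (-((n : ℕ) + 1) : ℤ) : ℂˣ) : ℂ) * p.1 n i = p.1 n i
      simp
    · show (((1 : ℂˣ) ^ (((n : ℕ) + 1 : ℕ) : ℤ) : ℂˣ) : ℂ) * p.2 n i = p.2 n i
      simp
  map_mul' := by
    intro a b
    funext p
    refine Prod.ext ?_ ?_ <;> funext n i
    · show (((a * b) ^ (-((n : ℕ) + 1) : ℤ) : ℂˣ) : ℂ) * p.1 n i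
        = ((a ^ (-((n : ℕ) + 1) : ℤ) : ℂˣ) : ℂ) *
            (((b ^ (-((n : ℕ) + 1) : ℤ) : ℂˣ) : ℂ) * p.1 n i)
      simp [mul_zpow]
      ring
    · show (((a * b) ^ (((n : ℕ) + 1 : ℕ) : ℤ) : ℂˣ) : ℂ) * p.2 n i
        = ((a ^ (((n : ℕ) + 1 : ℕ) : ℤ) : ℂˣ) : ℂ) *
            (((b ^ (((n : ℕ) + 1 : ℕ) : ℤ) : ℂˣ) : ℂ) * p.2 n i)
      simp [mul_zpow]
      ring

namespace SingularChains

open Finsupp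

/-- Finite tuples of points of `K`, of any length. -/
abbrev Tuple (K : Type) : Type := Σ k : ℕ, Fin k → K

/-- Rational chains on tuples of points of `K`. -/
abbrev TupleChain (K : Type) : Type := Tuple K →₀ ℚ

namespace TupleChain

variable {K L K' L' : Type}

/-- The basis chain given by a tuple. -/
noncomputable def of {k : ℕ} (v : Fin k → K) : TupleChain K := single ⟨k, v⟩ 1

/-- Coning off with apex `a`. -/
noncomputable def cone (a : K) : TupleChain K →ₗ[ℚ] TupleChain K :=
  lmapDomain ℚ ℚ fun p => ⟨p.1 + 1, Fin.cons a p.2⟩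

/-- The boundary of a single tuple. -/
noncomputable def bdry : ∀ {k : ℕ}, (Fin k → K) → TupleChain K
  | 0, _ => 0
  | k + 1, v => ∑ i : Fin (k + 1), (-1 : ℚ) ^ (i : ℕ) • of fun j : Fin k => v (i.succAbove j)

/-- The boundary operator. -/
noncomputable def d : TupleChain K →ₗ[ℚ] TupleChain K :=
  linearCombination ℚ fun p => bdry p.2

/-- The map induced on chains by a map of vertices. -/
noncomputable def map (f : K → L) : TupleChain K →ₗ[ℚ] TupleChain L :=
  lmapDomain ℚ ℚ fun p => ⟨p.1, f ∘ p.2⟩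

@[simp] lemma cone_of (a : K) {k : ℕ} (v : Fin k → K) :
    cone a (of v) = of (Fin.cons a v : Fin (k + 1) → K) := by
  simp [cone, of]

@[simp] lemma map_of (f : K → L) {k : ℕ} (v : Fin k → K) : map f (of v) = of (f ∘ v) := by
  simp [map, of]

@[simp] lemma d_of {k : ℕ} (v : Fin k → K) : d (of v) = bdry v := by
  simp [d, of]

lemma hom_ext {M : Type*} [AddCommGroup M] [Module ℚ M] {f g : TupleChain K →ₗ[ℚ] M}
    (h : ∀ (k : ℕ) (v : Fin k → K), f (of v) = g (of v)) : f = g := by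
  refine Finsupp.lhom_ext' fun p => LinearMap.ext_ring ?_
  exact h p.1 p.2

lemma map_cone (f : K → L) (a : K) (x : TupleChain K) :
    map f (cone a x) = cone (f a) (map f x) := by
  have : map f ∘ₗ cone a = cone (f a) ∘ₗ map f := hom_ext fun k v => by
    simp only [LinearMap.comp_apply, cone_of, map_of, Fin.comp_cons]
  exact LinearMap.congr_fun this x

lemma map_d (f : K → L) (x : TupleChain K) : map f (d x) = d (map f x) := by
  have : map f ∘ₗ d = d ∘ₗ map f := hom_ext fun k v => by
    cases k with
    | zero => simp [bdry]
    | succ k => simp [bdry, Function.comp_def]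
  exact LinearMap.congr_fun this x

lemma d_cone (a : K) (x : TupleChain K) : d (cone a x) = x - cone a (d x) := by
  have : d ∘ₗ cone a = LinearMap.id - cone a ∘ₗ d := hom_ext fun k v => by
    cases k with
    | zero =>
      simp only [LinearMap.comp_apply, cone_of, d_of, bdry, LinearMap.sub_apply, map_zero]
      simp
    | succ k =>
      simp only [LinearMap.comp_apply, cone_of, d_of, bdry, LinearMap.sub_apply, map_sum, map_smul]
      rw [Fin.sum_univ_succ]
      simp only [Fin.val_zero, pow_zero, one_smul, Fin.zero_succAbove, Fin.cons_succ,
        LinearMap.id_apply, sub_eq_add_neg, ← Finset.sum_neg_distrib]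
      congr 1
      refine Finset.sum_congr rfl fun i _ => ?_
      rw [Fin.val_succ, pow_succ, mul_neg_one, neg_smul]
      congr 3
      funext j
      refine Fin.cases ?_ (fun j => ?_) j <;> simp
  exact LinearMap.congr_fun this x

lemma of_succ {k : ℕ} (v : Fin (k + 1) → K) : of v = cone (v 0) (of (Fin.tail v)) := by
  rw [cone_of, Fin.cons_self_tail]

lemma d_d (x : TupleChain K) : d (d x) = 0 := by
  have : (d ∘ₗ d : TupleChain K →ₗ[ℚ] TupleChain K) = 0 := hom_ext fun k => by
    induction k with
    | zero => intro v; simp [bdry]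
    | succ k ih =>
      intro v
      have h := ih (Fin.tail v)
      simp only [LinearMap.comp_apply, LinearMap.zero_apply] at h ⊢
      rw [of_succ, d_cone, map_sub, d_cone, h]
      simp
  exact LinearMap.congr_fun this x

/-- The value on tuples of the chain homotopy `carrierHomotopy`. -/
noncomputable def carrierAux (φ ψ : TupleChain K →ₗ[ℚ] TupleChain L)
    (b : ∀ k : ℕ, (Fin (k + 1) → K) → L) : ∀ {k : ℕ}, (Fin k → K) → TupleChain L
  | 0, _ => 0
  | k + 1, v => cone (b k v) (φ (of v) - ψ (of v) -
      ∑ i : Fin (k + 1), (-1 : ℚ) ^ (i : ℕ) • carrierAux φ ψ b fun j : Fin k => v (i.succAbove j))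

/-- The chain homotopy between `φ` and `ψ` built by coning off with the apices `b`. -/
noncomputable def carrierHomotopy (φ ψ : TupleChain K →ₗ[ℚ] TupleChain L)
    (b : ∀ k : ℕ, (Fin (k + 1) → K) → L) : TupleChain K →ₗ[ℚ] TupleChain L :=
  linearCombination ℚ fun p => carrierAux φ ψ b p.2

section
variable (φ ψ : TupleChain K →ₗ[ℚ] TupleChain L) (b : ∀ k : ℕ, (Fin (k + 1) → K) → L)

lemma carrierHomotopy_of {k : ℕ} (v : Fin k → K) :
    carrierHomotopy φ ψ b (of v) = carrierAux φ ψ b v := by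
  simp [carrierHomotopy, of]

lemma carrierHomotopy_of_zero (v : Fin 0 → K) : carrierHomotopy φ ψ b (of v) = 0 := by
  rw [carrierHomotopy_of, carrierAux]

lemma carrierHomotopy_of_succ {k : ℕ} (v : Fin (k + 1) → K) :
    carrierHomotopy φ ψ b (of v) =
      cone (b k v) (φ (of v) - ψ (of v) - carrierHomotopy φ ψ b (d (of v))) := by
  rw [carrierHomotopy_of, carrierAux, d_of, bdry]
  simp [carrierHomotopy_of]

lemma d_carrierHomotopy (hφ : ∀ x, φ (d x) = d (φ x)) (hψ : ∀ x, ψ (d x) = d (ψ x))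
    (h0 : ∀ v : Fin 0 → K, φ (of v) = ψ (of v)) (x : TupleChain K) :
    d (carrierHomotopy φ ψ b x) = φ x - ψ x - carrierHomotopy φ ψ b (d x) := by
  have : d ∘ₗ carrierHomotopy φ ψ b = φ - ψ - carrierHomotopy φ ψ b ∘ₗ d := hom_ext fun k => by
    induction k with
    | zero => intro v; simp [carrierHomotopy_of_zero, h0, bdry]
    | succ k ih =>
      intro v
      have key : d (carrierHomotopy φ ψ b (d (of v))) = φ (d (of v)) - ψ (d (of v)) := by
        have h := d_d (of v)
        rw [d_of, bdry] at h ⊢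
        have h2 := congrArg (carrierHomotopy φ ψ b) h
        simp only [map_sum, map_smul, map_zero] at h h2 ⊢
        rw [← sub_zero (_ - _), ← h2, ← Finset.sum_sub_distrib, ← Finset.sum_sub_distrib]
        refine Finset.sum_congr rfl fun i _ => ?_
        have := ih fun j => v (i.succAbove j)
        simp only [LinearMap.comp_apply, LinearMap.sub_apply] at this
        rw [this, smul_sub, smul_sub]
      simp only [LinearMap.comp_apply, LinearMap.sub_apply]
      rw [carrierHomotopy_of_succ, d_cone, map_sub, map_sub, key, hφ, hψ]
      simp
  exact LinearMap.congr_fun this x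

end

lemma map_carrierHomotopy {φ ψ : TupleChain K →ₗ[ℚ] TupleChain L}
    {φ' ψ' : TupleChain K' →ₗ[ℚ] TupleChain L'} {b : ∀ k : ℕ, (Fin (k + 1) → K) → L}
    {b' : ∀ k : ℕ, (Fin (k + 1) → K') → L'} (f : K → K') (g : L → L')
    (hφ : ∀ x, map g (φ x) = φ' (map f x)) (hψ : ∀ x, map g (ψ x) = ψ' (map f x))
    (hb : ∀ k (v : Fin (k + 1) → K), g (b k v) = b' k (f ∘ v)) (x : TupleChain K) :
    map g (carrierHomotopy φ ψ b x) = carrierHomotopy φ' ψ' b' (map f x) := by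
  have : map g ∘ₗ carrierHomotopy φ ψ b = carrierHomotopy φ' ψ' b' ∘ₗ map f := hom_ext fun k => by
    induction k with
    | zero => intro v; simp [carrierHomotopy_of_zero]
    | succ k ih =>
      intro v
      simp only [LinearMap.comp_apply] at ih ⊢
      have key : map g (carrierHomotopy φ ψ b (d (of v))) =
          carrierHomotopy φ' ψ' b' (map f (d (of v))) := by
        rw [d_of, bdry]
        simp only [map_sum, map_smul, ih]
      rw [carrierHomotopy_of_succ, map_cone, map_sub (map g), map_sub (map g), key, hφ, hψ, hb, map_of,
        carrierHomotopy_of_succ, map_d, map_of]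
  exact LinearMap.congr_fun this x

/-- The value of barycentric subdivision on tuples, for a given choice `b` of barycentres. -/
noncomputable def subdivAux (b : ∀ k : ℕ, (Fin (k + 1) → K) → K) :
    ∀ {k : ℕ}, (Fin k → K) → TupleChain K
  | 0, v => of v
  | k + 1, v => cone (b k v)
      (∑ i : Fin (k + 1), (-1 : ℚ) ^ (i : ℕ) • subdivAux b fun j : Fin k => v (i.succAbove j))

/-- Barycentric subdivision, for a given choice `b` of barycentres. -/
noncomputable def subdiv (b : ∀ k : ℕ, (Fin (k + 1) → K) → K) : TupleChain K →ₗ[ℚ] TupleChain K :=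
  linearCombination ℚ fun p => subdivAux b p.2

section
variable (b : ∀ k : ℕ, (Fin (k + 1) → K) → K)

lemma subdiv_of {k : ℕ} (v : Fin k → K) : subdiv b (of v) = subdivAux b v := by
  simp [subdiv, of]

lemma subdiv_of_zero (v : Fin 0 → K) : subdiv b (of v) = of v := by
  rw [subdiv_of, subdivAux]

lemma subdiv_of_succ {k : ℕ} (v : Fin (k + 1) → K) :
    subdiv b (of v) = cone (b k v) (subdiv b (d (of v))) := by
  rw [subdiv_of, subdivAux, d_of, bdry]
  simp [subdiv_of]

lemma d_subdiv (x : TupleChain K) : d (subdiv b x) = subdiv b (d x) := by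
  have : d ∘ₗ subdiv b = subdiv b ∘ₗ d := hom_ext fun k => by
    induction k with
    | zero => intro v; simp [subdiv_of_zero, bdry]
    | succ k ih =>
      intro v
      simp only [LinearMap.comp_apply] at ih ⊢
      have key : d (subdiv b (d (of v))) = 0 := by
        have h := congrArg (subdiv b) (d_d (of v))
        rw [d_of, bdry] at h ⊢
        simp only [map_sum, map_smul, map_zero, ih] at h ⊢
        exact h
      rw [subdiv_of_succ, d_cone, key, map_zero, sub_zero]
  exact LinearMap.congr_fun this x

end

lemma map_subdiv {b : ∀ k : ℕ, (Fin (k + 1) → K) → K} {b' : ∀ k : ℕ, (Fin (k + 1) → L) → L}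
    (f : K → L) (hb : ∀ k (v : Fin (k + 1) → K), f (b k v) = b' k (f ∘ v)) (x : TupleChain K) :
    map f (subdiv b x) = subdiv b' (map f x) := by
  have : map f ∘ₗ subdiv b = subdiv b' ∘ₗ map f := hom_ext fun k => by
    induction k with
    | zero => intro v; simp [subdiv_of_zero]
    | succ k ih =>
      intro v
      simp only [LinearMap.comp_apply] at ih ⊢
      have key : map f (subdiv b (d (of v))) = subdiv b' (map f (d (of v))) := by
        rw [d_of, bdry]
        simp only [map_sum, map_smul, ih]
      rw [subdiv_of_succ, map_cone, key, hb, map_of, subdiv_of_succ, map_d, map_of]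
  exact LinearMap.congr_fun this x

end TupleChain

end SingularChains

namespace SingularChains

open Finsupp

/-- The topological simplex with `n` vertices; it is empty for `n = 0`. -/
abbrev Simplex (n : ℕ) : Type := stdSimplex ℝ (Fin n)

/-- The affine map between simplices sending the vertices to the given points. -/
noncomputable def affineMap {k n : ℕ} (v : Fin k → Simplex n) : C(Simplex k, Simplex n) where
  toFun t := ⟨∑ i, t.1 i • (v i).1,
    (convex_stdSimplex ℝ (Fin n)).sum_mem (fun i _ => t.2.1 i) t.2.2 fun i _ => (v i).2⟩
  continuous_toFun := Continuous.subtype_mk (continuous_finsetSum _ fun i _ =>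
    ((continuous_apply i).comp continuous_subtype_val).smul continuous_const) _

lemma affineMap_coe {k n : ℕ} (v : Fin k → Simplex n) (t : Simplex k) :
    (affineMap v t).1 = ∑ i, t.1 i • (v i).1 := rfl

/-- The vertices of the simplex. -/
noncomputable def vert {n : ℕ} (i : Fin n) : Simplex n := stdSimplex.vertex i

lemma affineMap_vert {k n : ℕ} (v : Fin k → Simplex n) (i : Fin k) :
    affineMap v (vert i) = v i := by
  apply Subtype.ext
  rw [affineMap_coe]
  simp [vert, Pi.single_apply, ite_smul]

lemma affineMap_affineMap {k l n : ℕ} (v : Fin k → Simplex n) (w : Fin l → Simplex k)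
    (t : Simplex l) : affineMap v (affineMap w t) = affineMap (fun i => affineMap v (w i)) t := by
  apply Subtype.ext
  simp only [affineMap_coe, Finset.sum_apply, Pi.smul_apply, smul_eq_mul, Finset.sum_smul,
    Finset.smul_sum, smul_smul]
  rw [Finset.sum_comm]

lemma affineMap_vert_self {n : ℕ} (t : Simplex n) : affineMap vert t = t := by
  apply Subtype.ext
  funext j
  simp [affineMap_coe, vert, Pi.single_apply]

/-- Spaces in which tuples of points span (possibly degenerate) singular simplices. -/
class ConvexLike (K : Type) [TopologicalSpace K] where
  /-- The singular simplex spanned by a tuple of points. -/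
  span : ∀ {k : ℕ}, (Fin k → K) → C(Simplex k, K)
  span_vert : ∀ {k : ℕ} (v : Fin k → K) (i : Fin k), span v (vert i) = v i
  span_affineMap : ∀ {k l : ℕ} (v : Fin k → K) (w : Fin l → Simplex k) (t : Simplex l),
    span v (affineMap w t) = span (fun i => span v (w i)) t

open ConvexLike

noncomputable instance (n : ℕ) : ConvexLike (Simplex n) where
  span := affineMap
  span_vert := affineMap_vert
  span_affineMap := affineMap_affineMap

noncomputable instance {K L : Type} [TopologicalSpace K] [TopologicalSpace L] [ConvexLike K]
    [ConvexLike L] : ConvexLike (K × L) where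
  span v := (span fun i => (v i).1).prodMk (span fun i => (v i).2)
  span_vert v i := by simp [span_vert]
  span_affineMap v w t := by simp [span_affineMap]

/-- The barycentre of a nonempty tuple of points. -/
noncomputable def bary {K : Type} [TopologicalSpace K] [ConvexLike K] (k : ℕ)
    (v : Fin (k + 1) → K) : K :=
  span v stdSimplex.barycenter

section Affine
variable {K : Type} [TopologicalSpace K] [ConvexLike K]

lemma span_comp {k l : ℕ} (v : Fin k → K) (w : Fin l → Simplex k) :
    (span v).comp (span w) = span (span v ∘ w) :=
  ContinuousMap.ext fun t => span_affineMap v w t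

lemma span_bary {k l : ℕ} (v : Fin k → K) (w : Fin (l + 1) → Simplex k) :
    span v (bary l w) = bary l (span v ∘ w) :=
  span_affineMap v w _

end Affine

/-- Singular simplices of all dimensions, including the empty one. -/
abbrev SingularSimplex (X : Type) [TopologicalSpace X] : Type := Σ n : ℕ, C(Simplex n, X)

/-- Augmented singular chains with rational coefficients, of all dimensions. -/
abbrev Chain (X : Type) [TopologicalSpace X] : Type := SingularSimplex X →₀ ℚ

namespace Chain

variable {X Y Z : Type} [TopologicalSpace X] [TopologicalSpace Y] [TopologicalSpace Z]
variable {K L : Type} [TopologicalSpace K] [ConvexLike K] [TopologicalSpace L] [ConvexLike L]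

/-- The basis chain given by a singular simplex. -/
noncomputable def of {n : ℕ} (σ : C(Simplex n, X)) : Chain X := single ⟨n, σ⟩ 1

/-- Realize a chain on tuples of points of `K` along a map from `K`. -/
noncomputable def push (σ : C(K, X)) : TupleChain K →ₗ[ℚ] Chain X :=
  lmapDomain ℚ ℚ fun p => ⟨p.1, σ.comp (span p.2)⟩

@[simp] lemma push_of (σ : C(K, X)) {k : ℕ} (v : Fin k → K) :
    push σ (.of v) = of (σ.comp (span v)) := by
  simp [push, of, TupleChain.of]

/-- The map on chains induced by a continuous map. -/
noncomputable def map (f : C(X, Y)) : Chain X →ₗ[ℚ] Chain Y :=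
  lmapDomain ℚ ℚ fun p => ⟨p.1, f.comp p.2⟩

@[simp] lemma map_of (f : C(X, Y)) {n : ℕ} (σ : C(Simplex n, X)) :
    map f (of σ) = of (f.comp σ) := by
  simp [map, of]

/-- The boundary of a singular simplex. -/
noncomputable def bdry : ∀ {n : ℕ}, C(Simplex n, X) → Chain X
  | 0, _ => 0
  | n + 1, σ => ∑ i : Fin (n + 1),
      (-1 : ℚ) ^ (i : ℕ) • of (σ.comp (affineMap fun j : Fin n => vert (i.succAbove j)))

/-- The boundary operator. -/
noncomputable def d : Chain X →ₗ[ℚ] Chain X :=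
  linearCombination ℚ fun p => bdry p.2

@[simp] lemma d_of {n : ℕ} (σ : C(Simplex n, X)) : d (of σ) = bdry σ := by
  simp [d, of]

lemma hom_ext {M : Type*} [AddCommGroup M] [Module ℚ M] {f g : Chain X →ₗ[ℚ] M}
    (h : ∀ (n : ℕ) (σ : C(Simplex n, X)), f (of σ) = g (of σ)) : f = g := by
  refine Finsupp.lhom_ext' fun p => LinearMap.ext_ring ?_
  exact h p.1 p.2

lemma d_push (σ : C(K, X)) (x : TupleChain K) : d (push σ x) = push σ (TupleChain.d x) := by
  have : d ∘ₗ push σ = push σ ∘ₗ TupleChain.d := TupleChain.hom_ext fun k v => by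
    cases k with
    | zero => simp [bdry, TupleChain.bdry]
    | succ k =>
      simp only [LinearMap.comp_apply, push_of, d_of, bdry, TupleChain.d_of, TupleChain.bdry,
        map_sum, map_smul]
      refine Finset.sum_congr rfl fun i _ => ?_
      congr 2
      ext t
      simp [span_affineMap, span_vert]
  exact LinearMap.congr_fun this x

lemma of_eq_push {n : ℕ} (σ : C(Simplex n, X)) : of σ = push σ (.of vert) := by
  rw [push_of]
  congr 1
  ext t
  exact congrArg σ (affineMap_vert_self t).symm

lemma d_d (x : Chain X) : d (d x) = 0 := by
  have : (d ∘ₗ d : Chain X →ₗ[ℚ] Chain X) = 0 := hom_ext fun n σ => by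
    rw [LinearMap.comp_apply, of_eq_push, d_push, d_push, TupleChain.d_d, map_zero,
      LinearMap.zero_apply]
  exact LinearMap.congr_fun this x

lemma map_push (f : C(X, Y)) (σ : C(K, X)) (x : TupleChain K) :
    map f (push σ x) = push (f.comp σ) x := by
  have : map f ∘ₗ push σ = push (f.comp σ) := TupleChain.hom_ext fun k v => by
    simp [ContinuousMap.comp_assoc]
  exact LinearMap.congr_fun this x

lemma map_d (f : C(X, Y)) (x : Chain X) : map f (d x) = d (map f x) := by
  have : map f ∘ₗ d = d ∘ₗ map f := hom_ext fun n σ => by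
    simp only [LinearMap.comp_apply]
    rw [of_eq_push, d_push, map_push, map_push, d_push]
  exact LinearMap.congr_fun this x

lemma map_map (g : C(Y, Z)) (f : C(X, Y)) (x : Chain X) :
    map g (map f x) = map (g.comp f) x := by
  have : map g ∘ₗ map f = map (g.comp f) := hom_ext fun n σ => by
    simp [ContinuousMap.comp_assoc]
  exact LinearMap.congr_fun this x

lemma map_id (x : Chain X) : map (ContinuousMap.id X) x = x := by
  have : map (ContinuousMap.id X) = LinearMap.id := hom_ext fun n σ => by simp
  exact LinearMap.congr_fun this x

lemma push_map_span (σ : C(K, X)) {k : ℕ} (v : Fin k → K) (x : TupleChain (Simplex k)) :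
    push σ (TupleChain.map (span v) x) = push (σ.comp (span v)) x := by
  have : push σ ∘ₗ TupleChain.map (span v) = push (σ.comp (span v)) :=
    TupleChain.hom_ext fun k w => by
      simp only [LinearMap.comp_apply, TupleChain.map_of, push_of, ContinuousMap.comp_assoc,
        span_comp]
  exact LinearMap.congr_fun this x

lemma vert_comp {k : ℕ} (v : Fin k → K) : span v ∘ vert = v := funext (span_vert v)

/-- Barycentric subdivision of singular chains. -/
noncomputable def subdiv : Chain X →ₗ[ℚ] Chain X :=
  linearCombination ℚ fun p => push p.2 (TupleChain.subdiv bary (.of vert))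

lemma subdiv_of {n : ℕ} (σ : C(Simplex n, X)) :
    subdiv (of σ) = push σ (TupleChain.subdiv bary (.of vert)) := by
  simp [subdiv, of]

lemma subdiv_push (σ : C(K, X)) (x : TupleChain K) :
    subdiv (push σ x) = push σ (TupleChain.subdiv bary x) := by
  have : subdiv ∘ₗ push σ = push σ ∘ₗ TupleChain.subdiv bary := TupleChain.hom_ext fun k v => by
    simp only [LinearMap.comp_apply, push_of]
    rw [subdiv_of, ← push_map_span, TupleChain.map_subdiv (span v) (fun k w => span_bary v w),
      TupleChain.map_of, vert_comp]
  exact LinearMap.congr_fun this x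

lemma d_subdiv (x : Chain X) : d (subdiv x) = subdiv (d x) := by
  have : (d ∘ₗ subdiv : Chain X →ₗ[ℚ] Chain X) = subdiv ∘ₗ d := hom_ext fun n σ => by
    simp only [LinearMap.comp_apply]
    rw [subdiv_of, d_push, TupleChain.d_subdiv, of_eq_push σ, d_push, subdiv_push]
  exact LinearMap.congr_fun this x

/-- The homotopy between the identity and subdivision, on chains of tuples. -/
noncomputable def tupleSubdivHomotopy : TupleChain K →ₗ[ℚ] TupleChain K :=
  TupleChain.carrierHomotopy LinearMap.id (TupleChain.subdiv bary) bary

/-- The homotopy between the identity and subdivision. -/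
noncomputable def subdivHomotopy : Chain X →ₗ[ℚ] Chain X :=
  linearCombination ℚ fun p => push p.2 (tupleSubdivHomotopy (.of vert))

lemma subdivHomotopy_of {n : ℕ} (σ : C(Simplex n, X)) :
    subdivHomotopy (of σ) = push σ (tupleSubdivHomotopy (.of vert)) := by
  simp [subdivHomotopy, of]

lemma subdivHomotopy_push (σ : C(K, X)) (x : TupleChain K) :
    subdivHomotopy (push σ x) = push σ (tupleSubdivHomotopy x) := by
  have : subdivHomotopy ∘ₗ push σ = push σ ∘ₗ tupleSubdivHomotopy :=
    TupleChain.hom_ext fun k v => by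
      simp only [LinearMap.comp_apply, push_of]
      rw [subdivHomotopy_of, ← push_map_span, tupleSubdivHomotopy,
        TupleChain.map_carrierHomotopy (span v) (span v) (φ' := LinearMap.id)
          (ψ' := TupleChain.subdiv bary) (b' := bary) (fun x => rfl)
          (TupleChain.map_subdiv (span v) fun k w => span_bary v w) (fun k w => span_bary v w),
        TupleChain.map_of, vert_comp, ← tupleSubdivHomotopy]
  exact LinearMap.congr_fun this x

lemma d_subdivHomotopy (x : Chain X) :
    d (subdivHomotopy x) = x - subdiv x - subdivHomotopy (d x) := by
  have : (d ∘ₗ subdivHomotopy : Chain X →ₗ[ℚ] Chain X) =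
      LinearMap.id - subdiv - subdivHomotopy ∘ₗ d := hom_ext fun n σ => by
    simp only [LinearMap.comp_apply, LinearMap.sub_apply, LinearMap.id_apply]
    rw [subdivHomotopy_of, d_push, tupleSubdivHomotopy, TupleChain.d_carrierHomotopy,
      ← tupleSubdivHomotopy, map_sub, map_sub, of_eq_push σ, d_push, subdivHomotopy_push,
      subdiv_push]
    · rfl
    · intro x; rfl
    · intro x; rw [TupleChain.d_subdiv]
    · intro v; rw [TupleChain.subdiv_of_zero]; rfl
  exact LinearMap.congr_fun this x

/-- The prism operator on chains of tuples. -/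
noncomputable def tuplePrism : TupleChain K →ₗ[ℚ] TupleChain (K × Simplex 2) :=
  TupleChain.carrierHomotopy (TupleChain.map fun a => (a, vert 1))
    (TupleChain.map fun a => (a, vert 0)) fun k v => (bary k v, vert 0)

/-- The prism operator of a homotopy. -/
noncomputable def prism (H : C(X × Simplex 2, Y)) : Chain X →ₗ[ℚ] Chain Y :=
  linearCombination ℚ fun p =>
    push (H.comp (p.2.prodMap (ContinuousMap.id _))) (tuplePrism (.of vert))

lemma prism_of (H : C(X × Simplex 2, Y)) {n : ℕ} (σ : C(Simplex n, X)) :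
    prism H (of σ) = push (H.comp (σ.prodMap (ContinuousMap.id _))) (tuplePrism (.of vert)) := by
  simp [prism, of]

lemma push_map_span_prodMap (H : C(K × Simplex 2, X)) {k : ℕ} (v : Fin k → K)
    (x : TupleChain (Simplex k × Simplex 2)) :
    push H (TupleChain.map (Prod.map (span v) id) x) =
      push (H.comp ((span v).prodMap (ContinuousMap.id _))) x := by
  have : push H ∘ₗ TupleChain.map (Prod.map (span v) id) =
      push (H.comp ((span v).prodMap (ContinuousMap.id _))) :=
    TupleChain.hom_ext fun k w => by
      simp only [LinearMap.comp_apply, TupleChain.map_of, push_of, ContinuousMap.comp_assoc]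
      congr 2
      ext t : 1
      exact Prod.ext (span_affineMap v (fun i => (w i).1) t).symm rfl
  exact LinearMap.congr_fun this x

lemma prism_push (H : C(X × Simplex 2, Y)) (σ : C(K, X)) (x : TupleChain K) :
    prism H (push σ x) = push (H.comp (σ.prodMap (ContinuousMap.id _))) (tuplePrism x) := by
  have : prism H ∘ₗ push σ = push (H.comp (σ.prodMap (ContinuousMap.id _))) ∘ₗ tuplePrism :=
    TupleChain.hom_ext fun k v => by
      have h : ∀ (e : Simplex 2) (x : TupleChain (Simplex k)),
          TupleChain.map (Prod.map (span v) id) (TupleChain.map (fun a => (a, e)) x) =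
            TupleChain.map (fun a => (a, e)) (TupleChain.map (span v) x) := by
        intro e x
        have : TupleChain.map (Prod.map (span v) id) ∘ₗ TupleChain.map (fun a => (a, e)) =
            TupleChain.map (fun a => (a, e)) ∘ₗ TupleChain.map (span v) :=
          TupleChain.hom_ext fun k w => by simp; rfl
        exact LinearMap.congr_fun this x
      have hb : ∀ (l : ℕ) (w : Fin (l + 1) → Simplex k),
          Prod.map (span v) id (bary l w, (vert 0 : Simplex 2)) = (bary l (span v ∘ w), vert 0) :=
        fun l w => Prod.ext (span_bary v w) rfl
      have e : H.comp ((σ.comp (span v)).prodMap (ContinuousMap.id (Simplex 2))) =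
          (H.comp (σ.prodMap (ContinuousMap.id _))).comp
            ((span v).prodMap (ContinuousMap.id _)) := rfl
      simp only [LinearMap.comp_apply, push_of]
      rw [prism_of, e, ← push_map_span_prodMap, tuplePrism,
        TupleChain.map_carrierHomotopy (span v) (Prod.map (span v) id) (h _) (h _)
          (b' := fun k w => (bary k w, vert 0))
          hb,
        TupleChain.map_of, vert_comp, ← tuplePrism]
  exact LinearMap.congr_fun this x

/-- The restriction of a homotopy to an endpoint. -/
def slice (H : C(X × Simplex 2, Y)) (e : Simplex 2) : C(X, Y) :=
  H.comp ((ContinuousMap.id X).prodMk (ContinuousMap.const X e))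

lemma push_tuple_slice (H : C(X × Simplex 2, Y)) (σ : C(K, X)) (i : Fin 2) (x : TupleChain K) :
    push (H.comp (σ.prodMap (ContinuousMap.id _)))
      (TupleChain.map (fun a => (a, (vert i : Simplex 2))) x) =
      map (slice H (vert i)) (push σ x) := by
  have : push (H.comp (σ.prodMap (ContinuousMap.id _))) ∘ₗ
      TupleChain.map (fun a => (a, (vert i : Simplex 2))) = map (slice H (vert i)) ∘ₗ push σ :=
    TupleChain.hom_ext fun k v => by
      simp only [LinearMap.comp_apply, TupleChain.map_of, push_of, map_of]
      congr 1
      ext t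
      have hc : (affineMap fun _ : Fin k => (vert i : Simplex 2)) t = vert i := by
        apply Subtype.ext
        rw [affineMap_coe, ← Finset.sum_smul, t.2.2, one_smul]
      exact congrArg H (Prod.ext rfl hc)
  exact LinearMap.congr_fun this x

lemma d_prism (H : C(X × Simplex 2, Y)) (x : Chain X) :
    d (prism H x) = map (slice H (vert 1)) x - map (slice H (vert 0)) x - prism H (d x) := by
  have : d ∘ₗ prism H =
      map (slice H (vert 1)) - map (slice H (vert 0)) - prism H ∘ₗ d := hom_ext fun n σ => by
    simp only [LinearMap.comp_apply, LinearMap.sub_apply]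
    rw [of_eq_push σ, prism_push, d_push, tuplePrism, TupleChain.d_carrierHomotopy,
      ← tuplePrism, map_sub, map_sub, d_push, prism_push, push_tuple_slice, push_tuple_slice]
    · exact TupleChain.map_d _
    · exact TupleChain.map_d _
    · intro v
      rw [TupleChain.map_of, TupleChain.map_of]
      congr 1
      exact Subsingleton.elim _ _
  exact LinearMap.congr_fun this x

end Chain

end SingularChains

namespace SingularChains

open Finsupp

lemma map_mem_of_supported {α : Type*} {M : Type*} [AddCommGroup M] [Module ℚ M]
    {f : (α →₀ ℚ) →ₗ[ℚ] M} {N : Submodule ℚ M} {s : Set α}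
    (h : ∀ p ∈ s, f (single p 1) ∈ N) {c : α →₀ ℚ} (hc : c ∈ supported ℚ ℚ s) : f c ∈ N := by
  rw [supported_eq_span_single] at hc
  have : Submodule.span ℚ ((fun i => single i (1 : ℚ)) '' s) ≤ N.comap f :=
    Submodule.span_le.2 (by rintro _ ⟨p, hp, rfl⟩; exact h p hp)
  exact this hc

namespace TupleChain
variable {K L : Type}

/-- The chains on tuples of length `k`. -/
noncomputable def length (K : Type) (k : ℕ) : Submodule ℚ (TupleChain K) :=
  supported ℚ ℚ {p | p.1 = k}

lemma of_mem_length {k : ℕ} (v : Fin k → K) : of v ∈ length K k :=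
  single_mem_supported ℚ _ rfl

lemma map_mem_of_length {M : Type*} [AddCommGroup M] [Module ℚ M]
    {f : TupleChain K →ₗ[ℚ] M} {N : Submodule ℚ M} {k : ℕ}
    (h : ∀ v : Fin k → K, f (of v) ∈ N) {c : TupleChain K} (hc : c ∈ length K k) : f c ∈ N :=
  map_mem_of_supported (s := {p : Tuple K | p.1 = k})
    (by rintro ⟨k, v⟩ rfl; exact h v) hc

lemma cone_mem_length (a : K) {k : ℕ} {x : TupleChain K} (hx : x ∈ length K k) :
    cone a x ∈ length K (k + 1) :=
  map_mem_of_length (fun v => by rw [cone_of]; exact of_mem_length _) hx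

lemma map_mem_length (f : K → L) {k : ℕ} {x : TupleChain K} (hx : x ∈ length K k) :
    map f x ∈ length L k :=
  map_mem_of_length (fun v => by rw [map_of]; exact of_mem_length _) hx

lemma d_mem_length {k : ℕ} {x : TupleChain K} (hx : x ∈ length K (k + 1)) : d x ∈ length K k :=
  map_mem_of_length (fun v => by
    rw [d_of]
    exact Submodule.sum_mem _ fun i _ => Submodule.smul_mem _ _ (of_mem_length _)) hx

lemma subdiv_mem_length (b : ∀ k : ℕ, (Fin (k + 1) → K) → K) {k : ℕ} {x : TupleChain K}
    (hx : x ∈ length K k) : subdiv b x ∈ length K k := by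
  induction k generalizing x with
  | zero => exact map_mem_of_length (fun v => by rw [subdiv_of_zero]; exact of_mem_length _) hx
  | succ k ih =>
    refine map_mem_of_length (fun v => ?_) hx
    rw [subdiv_of_succ]
    exact cone_mem_length _ (ih (d_mem_length (of_mem_length _)))

lemma carrierHomotopy_mem_length {φ ψ : TupleChain K →ₗ[ℚ] TupleChain L}
    (b : ∀ k : ℕ, (Fin (k + 1) → K) → L)
    (hφ : ∀ (k : ℕ) (x : TupleChain K), x ∈ length K k → φ x ∈ length L k)
    (hψ : ∀ (k : ℕ) (x : TupleChain K), x ∈ length K k → ψ x ∈ length L k)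
    {k : ℕ} {x : TupleChain K} (hx : x ∈ length K k) :
    carrierHomotopy φ ψ b x ∈ length L (k + 1) := by
  induction k generalizing x with
  | zero =>
    exact map_mem_of_length (fun v => by
      rw [carrierHomotopy_of_zero]; exact Submodule.zero_mem _) hx
  | succ k ih =>
    refine map_mem_of_length (fun v => ?_) hx
    rw [carrierHomotopy_of_succ]
    exact cone_mem_length _ (Submodule.sub_mem _ (Submodule.sub_mem _ (hφ _ _ (of_mem_length _))
      (hψ _ _ (of_mem_length _))) (ih (d_mem_length (of_mem_length _))))

end TupleChain

section
variable {X Y : Type} [TopologicalSpace X] [TopologicalSpace Y]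

/-- The singular simplices with image in `S`. -/
def simpIn (S : Set X) : Set (SingularSimplex X) := {p | ∀ t, p.2 t ∈ S}

/-- The singular simplices with `n` vertices. -/
def deg (X : Type) [TopologicalSpace X] (n : ℤ) : Set (SingularSimplex X) := {p | (p.1 : ℤ) = n}

lemma simpIn_mono {S T : Set X} (h : S ⊆ T) : simpIn S ⊆ simpIn T := fun _ hp t => h (hp t)

lemma simpIn_inter (S T : Set X) : simpIn (S ∩ T) = simpIn S ∩ simpIn T :=
  Set.ext fun _ => forall_and

lemma simpIn_univ : simpIn (Set.univ : Set X) = Set.univ := Set.eq_univ_of_forall fun _ _ => trivial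

namespace Chain

/-- The chains supported in a set of singular simplices. -/
noncomputable abbrev on (s : Set (SingularSimplex X)) : Submodule ℚ (Chain X) := supported ℚ ℚ s

lemma of_mem {n : ℕ} {σ : C(Simplex n, X)} {s : Set (SingularSimplex X)} (h : ⟨n, σ⟩ ∈ s) :
    of σ ∈ on s := single_mem_supported ℚ _ h

lemma map_mem_of_on {M : Type*} [AddCommGroup M] [Module ℚ M]
    {f : Chain X →ₗ[ℚ] M} {N : Submodule ℚ M} {s : Set (SingularSimplex X)}
    (h : ∀ (n : ℕ) (σ : C(Simplex n, X)), ⟨n, σ⟩ ∈ s → f (of σ) ∈ N) {c : Chain X}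
    (hc : c ∈ on s) : f c ∈ N :=
  map_mem_of_supported (fun p hp => h p.1 p.2 hp) hc

lemma mem_on_inter {s t : Set (SingularSimplex X)} {c : Chain X} :
    c ∈ on (s ∩ t) ↔ c ∈ on s ∧ c ∈ on t := by
  rw [on, supported_inter, Submodule.mem_inf]

variable {K : Type} [TopologicalSpace K] [ConvexLike K]

lemma push_mem_simpIn {σ : C(K, X)} {S : Set X} (h : ∀ a, σ a ∈ S) (x : TupleChain K) :
    push σ x ∈ on (simpIn S) :=
  map_mem_of_supported (s := Set.univ) (fun p _ => by
    have : push σ (single p 1) = _ := push_of σ p.2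
    rw [this]
    exact of_mem fun t => h _) (by simp)

lemma push_mem_deg (σ : C(K, X)) {k : ℕ} {x : TupleChain K} (hx : x ∈ TupleChain.length K k) :
    push σ x ∈ on (deg X k) :=
  TupleChain.map_mem_of_length (fun v => by
    rw [push_of]; exact of_mem rfl) hx

/-- The linear map `f` does not leave the subspaces of `X` it starts in and shifts degrees
by `m`. -/
structure IsLocal (f : Chain X →ₗ[ℚ] Chain X) (m : ℤ) : Prop where
  map_simpIn : ∀ {S : Set X} {c : Chain X}, c ∈ on (simpIn S) → f c ∈ on (simpIn S)
  map_deg : ∀ {n : ℤ} {c : Chain X}, c ∈ on (deg X n) → f c ∈ on (deg X (n + m))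

lemma isLocal_d : IsLocal (d : Chain X →ₗ[ℚ] Chain X) (-1) where
  map_simpIn := map_mem_of_on fun n σ hσ => by
    rw [of_eq_push, d_push]; exact push_mem_simpIn hσ _
  map_deg := fun {m} _ hc => map_mem_of_on (fun n σ (hσ : (n : ℤ) = m) => by
    subst hσ
    cases n with
    | zero => rw [d_of]; exact Submodule.zero_mem _
    | succ n =>
      rw [of_eq_push, d_push]
      have := push_mem_deg σ (TupleChain.d_mem_length
        (TupleChain.of_mem_length (vert : Fin (n + 1) → Simplex (n + 1))))
      simpa using this) hc

lemma isLocal_subdiv : IsLocal (subdiv : Chain X →ₗ[ℚ] Chain X) 0 where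
  map_simpIn := map_mem_of_on fun n σ hσ => by
    rw [subdiv_of]; exact push_mem_simpIn hσ _
  map_deg := fun {m} _ hc => map_mem_of_on (fun n σ (hσ : (n : ℤ) = m) => by
    subst hσ
    rw [subdiv_of, add_zero]
    exact push_mem_deg σ (TupleChain.subdiv_mem_length _ (TupleChain.of_mem_length _))) hc

lemma isLocal_subdivHomotopy : IsLocal (subdivHomotopy : Chain X →ₗ[ℚ] Chain X) 1 where
  map_simpIn := map_mem_of_on fun n σ hσ => by
    rw [subdivHomotopy_of]; exact push_mem_simpIn hσ _
  map_deg := fun {m} _ hc => map_mem_of_on (fun n σ (hσ : (n : ℤ) = m) => by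
    subst hσ
    rw [subdivHomotopy_of]
    exact push_mem_deg σ (TupleChain.carrierHomotopy_mem_length _ (fun k x h => h)
      (fun k x h => TupleChain.subdiv_mem_length _ h) (TupleChain.of_mem_length _))) hc

lemma prism_mem_simpIn {H : C(X × Simplex 2, Y)} {S : Set X} {T : Set Y}
    (h : ∀ x ∈ S, ∀ e, H (x, e) ∈ T) {c : Chain X} (hc : c ∈ on (simpIn S)) :
    prism H c ∈ on (simpIn T) :=
  map_mem_of_on (fun n σ hσ => by
    rw [prism_of]; exact push_mem_simpIn (fun a => h _ (hσ a.1) a.2) _) hc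

lemma prism_mem_deg (H : C(X × Simplex 2, Y)) {n : ℤ} {c : Chain X} (hc : c ∈ on (deg X n)) :
    prism H c ∈ on (deg Y (n + 1)) :=
  map_mem_of_on (fun m σ (hσ : (m : ℤ) = n) => by
    subst hσ
    rw [prism_of]
    exact push_mem_deg _ (TupleChain.carrierHomotopy_mem_length _
      (fun k x h => TupleChain.map_mem_length _ h)
      (fun k x h => TupleChain.map_mem_length _ h) (TupleChain.of_mem_length _))) hc

lemma map_mem_simpIn {f : C(X, Y)} {S : Set X} {T : Set Y} (h : Set.MapsTo f S T) {c : Chain X}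
    (hc : c ∈ on (simpIn S)) : map f c ∈ on (simpIn T) :=
  map_mem_of_on (fun n σ hσ => by rw [map_of]; exact of_mem fun t => h (hσ t)) hc

lemma map_mem_deg (f : C(X, Y)) {n : ℤ} {c : Chain X} (hc : c ∈ on (deg X n)) :
    map f c ∈ on (deg Y n) :=
  map_mem_of_on (fun n σ hσ => by rw [map_of]; exact of_mem hσ) hc

lemma d_mem_deg {n : ℤ} {c : Chain X} (hc : c ∈ on (deg X (n + 1))) : d c ∈ on (deg X n) := by
  simpa using isLocal_d.map_deg hc

end Chain

open Chain

/-- Vanishing of the homology of the pair `(t, s)` in degree `n`, for sets of simplices. -/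
def Acyc (n : ℤ) (s t : Set (SingularSimplex X)) : Prop :=
  ∀ c ∈ on (t ∩ deg X n), d c ∈ on s → ∃ w ∈ on (t ∩ deg X (n + 1)), c - d w ∈ on s

namespace Acyc
variable {n : ℤ} {s t u : Set (SingularSimplex X)}

lemma trans (hst : s ⊆ t) (htu : t ⊆ u) (h1 : Acyc n s t) (h2 : Acyc n t u) : Acyc n s u := by
  intro c hc hdc
  obtain ⟨w, hw, hcw⟩ := h2 c hc (supported_mono hst hdc)
  rw [mem_on_inter] at hc hw
  obtain ⟨w', hw', hcw'⟩ := h1 (c - d w)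
    (mem_on_inter.2 ⟨hcw, Submodule.sub_mem _ hc.2 (d_mem_deg hw.2)⟩)
    (by rwa [map_sub, d_d, sub_zero])
  rw [mem_on_inter] at hw'
  refine ⟨w + w', mem_on_inter.2 ⟨Submodule.add_mem _ hw.1 (supported_mono htu hw'.1),
    Submodule.add_mem _ hw.2 hw'.2⟩, ?_⟩
  rwa [map_add, ← sub_sub]

lemma of_trans_left (hst : s ⊆ t) (htu : t ⊆ u) (h1 : Acyc n s u) (h2 : Acyc (n + 1) t u) :
    Acyc n s t := by
  intro c hc hdc
  rw [mem_on_inter] at hc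
  obtain ⟨w, hw, hcw⟩ := h1 c (mem_on_inter.2 ⟨supported_mono htu hc.1, hc.2⟩) hdc
  have hw2 := (mem_on_inter.1 hw).2
  obtain ⟨w', hw', hww'⟩ := h2 w hw (by
    have := Submodule.sub_mem _ hc.1 (supported_mono hst hcw)
    rwa [sub_sub_cancel] at this)
  rw [mem_on_inter] at hw'
  refine ⟨w - d w', mem_on_inter.2 ⟨hww', Submodule.sub_mem _ hw2 (d_mem_deg hw'.2)⟩, ?_⟩
  rwa [map_sub, d_d, sub_zero]

lemma of_trans_right (hst : s ⊆ t) (htu : t ⊆ u) (h1 : Acyc n s t) (h2 : Acyc (n + 1) s u) :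
    Acyc (n + 1) t u := by
  intro c hc hdc
  rw [mem_on_inter] at hc
  obtain ⟨w, hw, hcw⟩ := h1 (d c) (mem_on_inter.2 ⟨hdc, d_mem_deg hc.2⟩)
    (by rw [d_d]; exact Submodule.zero_mem _)
  rw [mem_on_inter] at hw
  obtain ⟨v, hv, hcv⟩ := h2 (c - w) (mem_on_inter.2
    ⟨Submodule.sub_mem _ hc.1 (supported_mono htu hw.1), Submodule.sub_mem _ hc.2 hw.2⟩)
    (by rwa [map_sub])
  refine ⟨v, hv, ?_⟩
  have := Submodule.add_mem _ (supported_mono hst hcv) hw.1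
  rwa [show c - w - d v + w = c - d v by abel] at this

lemma left_iff (hst : s ⊆ t) (htu : t ⊆ u) (h : ∀ n, Acyc n t u) : Acyc n s t ↔ Acyc n s u :=
  ⟨fun h1 => h1.trans hst htu (h n), fun h1 => h1.of_trans_left hst htu (h _)⟩

lemma shift_iff (hst : s ⊆ t) (htu : t ⊆ u) (h : ∀ n, Acyc n s u) :
    Acyc n s t ↔ Acyc (n + 1) t u :=
  ⟨fun h1 => of_trans_right hst htu h1 (h _), fun h1 => of_trans_left hst htu (h n) h1⟩

lemma refl (n : ℤ) (s : Set (SingularSimplex X)) : Acyc n s s := fun c hc _ =>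
  ⟨0, Submodule.zero_mem _, by simpa using (mem_on_inter.1 hc).1⟩

/-- Being closed under passing to the boundary. -/
def Closed (s : Set (SingularSimplex X)) : Prop := ∀ ⦃c : Chain X⦄, c ∈ on s → d c ∈ on s

lemma closed_simpIn (S : Set X) : Closed (simpIn S) := fun _ h => isLocal_d.map_simpIn h

lemma excision (hs : Closed s) (ht : Closed t) : Acyc n (s ∩ t) s ↔ Acyc n t (s ∪ t) := by
  constructor
  · intro h c hc hdc
    rw [Set.union_inter_distrib_right, on, supported_union, Submodule.mem_sup] at hc
    obtain ⟨p, hp, q, hq, rfl⟩ := hc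
    rw [map_add] at hdc
    have hq1 := (mem_on_inter.1 hq).1
    obtain ⟨w, hw, hpw⟩ := h p hp (mem_on_inter.2 ⟨hs (mem_on_inter.1 hp).1, by
      simpa using Submodule.sub_mem _ hdc (ht hq1)⟩)
    refine ⟨w, supported_mono (Set.inter_subset_inter_left _ Set.subset_union_left) hw, ?_⟩
    have := Submodule.add_mem _ (mem_on_inter.1 hpw).2 hq1
    rwa [show p - d w + q = p + q - d w by abel] at this
  · intro h c hc hdc
    obtain ⟨w, hw, hcw⟩ := h c
      (supported_mono (Set.inter_subset_inter_left _ Set.subset_union_left) hc)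
      (mem_on_inter.1 hdc).2
    rw [Set.union_inter_distrib_right, on, supported_union, Submodule.mem_sup] at hw
    obtain ⟨p, hp, q, hq, rfl⟩ := hw
    have hp1 := (mem_on_inter.1 hp).1
    have hq1 := (mem_on_inter.1 hq).1
    refine ⟨p, hp, mem_on_inter.2 ⟨Submodule.sub_mem _ (mem_on_inter.1 hc).1 (hs hp1), ?_⟩⟩
    have := Submodule.add_mem _ hcw (ht hq1)
    rwa [map_add, show c - (d p + d q) + d q = c - d p by abel] at this

/-- A deformation of `S` into `T` inside `S`, keeping `T` in itself. -/
lemma of_deformation {S T : Set X} (H : C(X × Simplex 2, X))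
    (h0 : ∀ x, H (x, vert 0) = x) (hS : ∀ x ∈ S, ∀ e, H (x, e) ∈ S)
    (hTT : ∀ x ∈ T, ∀ e, H (x, e) ∈ T) (h1 : ∀ x ∈ S, H (x, vert 1) ∈ T) (n : ℤ) :
    Acyc n (simpIn T) (simpIn S) := by
  intro c hc hdc
  rw [mem_on_inter] at hc
  have e := d_prism H c
  have h0' : slice H (vert 0) = ContinuousMap.id X := ContinuousMap.ext h0
  rw [h0', map_id] at e
  refine ⟨-prism H c, mem_on_inter.2 ⟨Submodule.neg_mem _ (prism_mem_simpIn hS hc.1),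
    Submodule.neg_mem _ (prism_mem_deg H hc.2)⟩, ?_⟩
  rw [map_neg, e, show c - -(map (slice H (vert 1)) c - c - prism H (d c)) =
    map (slice H (vert 1)) c - prism H (d c) by abel]
  exact Submodule.sub_mem _ (map_mem_simpIn (f := slice H (vert 1)) h1 hc.1) (prism_mem_simpIn hTT hdc)

end Acyc

end

end SingularChains

namespace SingularChains

open Finsupp Filter Topology

section
variable {n : ℕ}

lemma dist_affineMap_le {k : ℕ} (w : Fin k → Simplex n) (t : Simplex k) {q : Simplex n} {s : ℝ}
    (h : ∀ i, dist q (w i) ≤ s) : dist q (affineMap w t) ≤ s := by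
  rw [dist_comm, Subtype.dist_eq, ← Metric.mem_closedBall]
  rw [affineMap_coe]
  refine (convex_closedBall q.1 s).sum_mem (fun i _ => t.2.1 i) t.2.2 fun i _ => ?_
  rw [Metric.mem_closedBall, dist_comm]
  exact h i

lemma dist_bary_le {k : ℕ} (hk : k ≤ n) (v : Fin (k + 1) → Simplex (n + 1)) {r : ℝ}
    (h : ∀ i j, dist (v i) (v j) ≤ r) (j : Fin (k + 1)) :
    dist (v j) (bary k v) ≤ (1 - 1 / (n + 1)) * r := by
  have hr : 0 ≤ r := dist_nonneg.trans (h 0 0)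
  have e : (bary k v).1 - (v j).1 = ∑ i, (1 / ((k : ℝ) + 1)) • ((v i).1 - (v j).1) := by
    have hb : (bary k v).1 = ∑ i, (1 / ((k : ℝ) + 1)) • (v i).1 := by
      rw [bary]
      refine (affineMap_coe _ _).trans (Finset.sum_congr rfl fun i _ => ?_)
      congr 1
      simp
    rw [hb]
    simp only [smul_sub, Finset.sum_sub_distrib]
    rw [← Finset.sum_smul]
    have : (k : ℝ) + 1 ≠ 0 := by positivity
    simp [this]
  rw [dist_comm, Subtype.dist_eq, dist_eq_norm, e]
  have h1 : ∀ i, ‖(1 / ((k : ℝ) + 1)) • ((v i).1 - (v j).1)‖ ≤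
      if i = j then 0 else 1 / ((k : ℝ) + 1) * r := fun i => by
    split_ifs with hij
    · simp [hij]
    · rw [norm_smul, Real.norm_of_nonneg (by positivity), ← dist_eq_norm]
      exact mul_le_mul_of_nonneg_left (h i j) (by positivity)
  refine (norm_sum_le _ _).trans ((Finset.sum_le_sum fun i _ => h1 i).trans ?_)
  rw [Finset.sum_ite, Finset.sum_const_zero, zero_add, Finset.sum_const, Finset.filter_ne',
    Finset.card_erase_of_mem (Finset.mem_univ _), Finset.card_univ, Fintype.card_fin,
    Nat.add_sub_cancel, nsmul_eq_mul, ← mul_assoc]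
  refine mul_le_mul_of_nonneg_right ?_ hr
  have hkn : (k : ℝ) ≤ n := by exact_mod_cast hk
  have h2 : 1 / ((n : ℝ) + 1) ≤ 1 / ((k : ℝ) + 1) := by gcongr
  have h3 : (k : ℝ) * (1 / (k + 1)) = 1 - 1 / (k + 1) := by field_simp; ring
  linarith

/-- The tuples of points in the hull of `v` with mutual distance at most `ρ`. -/
def smallTuples {k : ℕ} (v : Fin k → Simplex n) (ρ : ℝ) : Set (Tuple (Simplex n)) :=
  {p | (∀ q s, (∀ j, dist q (v j) ≤ s) → ∀ i, dist q (p.2 i) ≤ s) ∧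
    ∀ i j, dist (p.2 i) (p.2 j) ≤ ρ}

lemma subdiv_of_mem_smallTuples {k : ℕ} (hk : k ≤ n + 1) (v : Fin k → Simplex (n + 1)) {r : ℝ}
    (h : ∀ i j, dist (v i) (v j) ≤ r) :
    TupleChain.subdiv bary (.of v) ∈
      supported ℚ ℚ (smallTuples v ((1 - 1 / (n + 1)) * r)) := by
  induction k with
  | zero =>
    rw [TupleChain.subdiv_of_zero]
    exact single_mem_supported ℚ _ ⟨fun q s _ i => i.elim0, fun i => i.elim0⟩
  | succ k ih =>
    have hb := dist_bary_le (Nat.le_of_succ_le_succ hk) v h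
    have hr : 0 ≤ (1 - 1 / ((n : ℝ) + 1)) * r := dist_nonneg.trans (hb 0)
    rw [TupleChain.subdiv_of_succ]
    have key : TupleChain.subdiv bary (TupleChain.d (.of v)) ∈
        supported ℚ ℚ (smallTuples v ((1 - 1 / (n + 1)) * r)) := by
      rw [TupleChain.d_of, TupleChain.bdry]
      simp only [map_sum, map_smul]
      refine Submodule.sum_mem _ fun i _ => Submodule.smul_mem _ _ ?_
      refine supported_mono ?_ (ih (by omega) (fun j => v (i.succAbove j)) fun _ _ => h _ _)
      rintro p ⟨h1, h2⟩
      exact ⟨fun q s hq => h1 q s fun j => hq _, h2⟩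
    refine map_mem_of_supported ?_ key
    rintro ⟨l, w⟩ ⟨h1, h2⟩
    have : TupleChain.cone (bary k v) (single ⟨l, w⟩ 1) = _ := TupleChain.cone_of (bary k v) w
    rw [this]
    refine single_mem_supported ℚ _ ⟨fun q s hq i => ?_, fun i j => ?_⟩
    · refine Fin.cases ?_ (fun i => ?_) i
      · exact dist_affineMap_le v _ hq
      · exact h1 q s hq i
    · have hw : ∀ i, dist (bary k v) (w i) ≤ (1 - 1 / (n + 1)) * r := fun i =>
        h1 _ _ (fun j => by rw [dist_comm]; exact hb j) i
      refine Fin.cases ?_ (fun i => ?_) i <;> refine Fin.cases ?_ (fun j => ?_) j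
      · simpa using hr
      · exact hw j
      · exact (dist_comm _ _).trans_le (hw i)
      · exact h2 i j

lemma subdiv_pow_mem_small (m : ℕ) :
    ((TupleChain.subdiv bary) ^ m) (.of (vert : Fin (n + 1) → Simplex (n + 1))) ∈
      supported ℚ ℚ {p | p.1 = n + 1 ∧ ∀ i j, dist (p.2 i) (p.2 j) ≤
        (1 - 1 / ((n : ℝ) + 1)) ^ m * Metric.diam (Set.univ : Set (Simplex (n + 1)))} := by
  induction m with
  | zero =>
    refine single_mem_supported ℚ _ ⟨rfl, fun i j => ?_⟩
    rw [pow_zero, one_mul]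
    exact Metric.dist_le_diam_of_mem isCompact_univ.isBounded trivial trivial
  | succ m ih =>
    rw [pow_succ' (TupleChain.subdiv bary), Module.End.mul_apply]
    refine map_mem_of_supported ?_ ih
    rintro ⟨k, v⟩ ⟨rfl, h⟩
    have h1 := subdiv_of_mem_smallTuples le_rfl v h
    have h2 := TupleChain.subdiv_mem_length bary (TupleChain.of_mem_length v)
    have h3 := Submodule.mem_inf.2 ⟨h2, h1⟩
    rw [TupleChain.length, ← supported_inter] at h3
    refine supported_mono ?_ h3
    rintro p ⟨hp1, hp2⟩
    refine ⟨hp1, fun i j => ?_⟩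
    rw [pow_succ', mul_assoc]
    exact hp2.2 i j

end

section
variable {X : Type} [TopologicalSpace X]

namespace Chain

lemma subdiv_pow_push {K : Type} [TopologicalSpace K] [ConvexLike K] (σ : C(K, X))
    (x : TupleChain K) (m : ℕ) :
    (subdiv ^ m) (push σ x) = push σ ((TupleChain.subdiv bary ^ m) x) := by
  induction m with
  | zero => rfl
  | succ m ih => rw [pow_succ', Module.End.mul_apply, ih, subdiv_push, pow_succ',
      Module.End.mul_apply]

lemma IsLocal.on_union {f : Chain X →ₗ[ℚ] Chain X} {m : ℤ} (hf : IsLocal f m) {S T : Set X}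
    {c : Chain X} (hc : c ∈ on (simpIn S ∪ simpIn T)) : f c ∈ on (simpIn S ∪ simpIn T) := by
  rw [on, supported_union, Submodule.mem_sup] at hc
  obtain ⟨p, hp, q, hq, rfl⟩ := hc
  rw [map_add]
  exact Submodule.add_mem _ (supported_mono Set.subset_union_left (hf.map_simpIn hp))
    (supported_mono Set.subset_union_right (hf.map_simpIn hq))

lemma exists_subdiv_pow_homotopy (m : ℕ) : ∃ T : Chain X →ₗ[ℚ] Chain X,
    IsLocal T 1 ∧ ∀ x, d (T x) = x - (subdiv ^ m) x - T (d x) := by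
  induction m with
  | zero => exact ⟨0, ⟨fun _ => Submodule.zero_mem _, fun _ => Submodule.zero_mem _⟩,
      fun x => by simp⟩
  | succ m ih =>
    obtain ⟨T, hT, hd⟩ := ih
    refine ⟨subdivHomotopy + subdiv ∘ₗ T, ⟨fun h => ?_, fun h => ?_⟩, fun x => ?_⟩
    · exact Submodule.add_mem _ (isLocal_subdivHomotopy.map_simpIn h)
        (isLocal_subdiv.map_simpIn (hT.map_simpIn h))
    · exact Submodule.add_mem _ (isLocal_subdivHomotopy.map_deg h)
        (by simpa using isLocal_subdiv.map_deg (hT.map_deg h))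
    · simp only [LinearMap.add_apply, LinearMap.comp_apply, map_add, d_subdivHomotopy, d_subdiv,
        hd, map_sub, pow_succ', Module.End.mul_apply]
      abel

lemma eventually_small_of {n : ℕ} (σ : C(Simplex n, X)) {S O₁ O₂ : Set X} (h₁ : IsOpen O₁)
    (h₂ : IsOpen O₂) (hS : S ⊆ O₁ ∪ O₂) (hσ : ∀ t, σ t ∈ S) :
    ∀ᶠ m in atTop, (subdiv ^ m) (of σ) ∈ on (simpIn (S ∩ O₁) ∪ simpIn (S ∩ O₂)) := by
  cases n with
  | zero =>
    refine Eventually.of_forall fun m => ?_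
    have h0 : of σ ∈ on (simpIn (S ∩ O₁)) :=
      of_mem fun t => by have := t.2.2; simp at this
    obtain ⟨T, hT, hd⟩ := exists_subdiv_pow_homotopy (X := X) m
    have e : (subdiv ^ m) (of σ) = of σ - d (T (of σ)) - T (d (of σ)) := by rw [hd]; abel
    rw [e]
    exact supported_mono Set.subset_union_left (Submodule.sub_mem _ (Submodule.sub_mem _ h0
      (isLocal_d.map_simpIn (hT.map_simpIn h0))) (hT.map_simpIn (isLocal_d.map_simpIn h0)))
  | succ n =>
    obtain ⟨δ, hδ, hball⟩ := lebesgue_number_lemma_of_metric (s := Set.univ)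
      (c := fun b : Bool => σ ⁻¹' (if b then O₁ else O₂)) isCompact_univ
      (fun b => by cases b <;> exact IsOpen.preimage σ.continuous (by assumption))
      (fun t _ => by
        rw [Set.mem_iUnion]
        rcases hS (hσ t) with h | h
        · exact ⟨true, h⟩
        · exact ⟨false, h⟩)
    have hlim : Tendsto (fun m : ℕ => (1 - 1 / ((n : ℝ) + 1)) ^ m *
        Metric.diam (Set.univ : Set (Simplex (n + 1)))) atTop
        (𝓝 (0 * Metric.diam (Set.univ : Set (Simplex (n + 1))))) := by
      refine (tendsto_pow_atTop_nhds_zero_of_lt_one ?_ ?_).mul_const _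
      · have : 1 / ((n : ℝ) + 1) ≤ 1 := by
          rw [div_le_one (by positivity)]; linarith [(n.cast_nonneg : (0 : ℝ) ≤ n)]
        linarith
      · have : 0 < 1 / ((n : ℝ) + 1) := by positivity
        linarith
    rw [zero_mul] at hlim
    filter_upwards [hlim.eventually_lt_const hδ] with m hm
    rw [of_eq_push, subdiv_pow_push]
    refine map_mem_of_supported ?_ (subdiv_pow_mem_small m)
    rintro ⟨k, w⟩ ⟨rfl, hw⟩
    have e : push σ (single ⟨_, w⟩ 1) = _ := push_of σ w
    rw [e]
    have key : ∀ t, affineMap w t ∈ Metric.ball (w 0) δ := fun t => by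
      rw [Metric.mem_ball, dist_comm]
      exact (dist_affineMap_le w t fun i => hw 0 i).trans_lt hm
    obtain ⟨b, hb⟩ := hball (w 0) trivial
    refine of_mem ?_
    cases b
    · exact Or.inr fun t => ⟨hσ _, hb (key t)⟩
    · exact Or.inl fun t => ⟨hσ _, hb (key t)⟩

lemma eventually_small {S O₁ O₂ : Set X} (h₁ : IsOpen O₁) (h₂ : IsOpen O₂) (hS : S ⊆ O₁ ∪ O₂)
    {c : Chain X} (hc : c ∈ on (simpIn S)) :
    ∀ᶠ m in atTop, (subdiv ^ m) c ∈ on (simpIn (S ∩ O₁) ∪ simpIn (S ∩ O₂)) := by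
  let N : Submodule ℚ (Chain X) :=
    { carrier := {c | ∀ᶠ m in atTop, (subdiv ^ m) c ∈ on (simpIn (S ∩ O₁) ∪ simpIn (S ∩ O₂))}
      add_mem' := fun ha hb => by
        filter_upwards [ha, hb] with m h h'
        rw [map_add]; exact Submodule.add_mem _ h h'
      zero_mem' := Eventually.of_forall fun m => by rw [map_zero]; exact Submodule.zero_mem _
      smul_mem' := fun q a ha => by
        filter_upwards [ha] with m h
        rw [map_smul]; exact Submodule.smul_mem _ _ h }
  have : LinearMap.id c ∈ N :=
    map_mem_of_on (s := simpIn S) (fun n σ hσ => eventually_small_of σ h₁ h₂ hS hσ) hc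
  exact this

end Chain

open Chain

namespace Acyc

lemma small {S O₁ O₂ : Set X} (h₁ : IsOpen O₁) (h₂ : IsOpen O₂) (hS : S ⊆ O₁ ∪ O₂) (n : ℤ) :
    Acyc n (simpIn (S ∩ O₁) ∪ simpIn (S ∩ O₂)) (simpIn S) := by
  intro c hc hdc
  rw [mem_on_inter] at hc
  obtain ⟨m, hm⟩ := (eventually_small h₁ h₂ hS hc.1).exists
  obtain ⟨T, hT, hd⟩ := exists_subdiv_pow_homotopy (X := X) m
  refine ⟨T c, mem_on_inter.2 ⟨hT.map_simpIn hc.1, hT.map_deg hc.2⟩, ?_⟩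
  rw [hd, show c - (c - (subdiv ^ m) c - T (d c)) = (subdiv ^ m) c + T (d c) by abel]
  exact Submodule.add_mem _ hm (hT.on_union hdc)

/-- Excision for two subsets that are relatively open in their union. -/
lemma excision_simpIn {S T O₁ O₂ : Set X} (h₁ : IsOpen O₁) (h₂ : IsOpen O₂)
    (hS : (S ∪ T) ∩ O₁ = S) (hT : (S ∪ T) ∩ O₂ = T) {n : ℤ} :
    Acyc n (simpIn (S ∩ T)) (simpIn S) ↔ Acyc n (simpIn T) (simpIn (S ∪ T)) := by
  rw [simpIn_inter, excision (closed_simpIn S) (closed_simpIn T)]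
  refine left_iff Set.subset_union_right
    (Set.union_subset (simpIn_mono Set.subset_union_left) (simpIn_mono Set.subset_union_right))
    fun n => ?_
  have := small (S := S ∪ T) h₁ h₂ (by
    rintro x (hx | hx)
    · rw [← hS] at hx; exact Or.inl hx.2
    · rw [← hT] at hx; exact Or.inr hx.2) n
  rwa [hS, hT] at this

end Acyc

end

end SingularChains

namespace SingularChains

open Finsupp Filter Topology Chain

section
variable {X Y : Type} [TopologicalSpace X] [TopologicalSpace Y]

/-- The map on singular simplices given by a continuous map. -/
def simpMap (f : C(X, Y)) (p : SingularSimplex X) : SingularSimplex Y := ⟨p.1, f.comp p.2⟩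

lemma simpMap_injective {f : C(X, Y)} (hf : Function.Injective f) :
    Function.Injective (simpMap f) := by
  rintro ⟨n, σ⟩ ⟨m, τ⟩ h
  obtain ⟨rfl, h⟩ := Sigma.mk.inj_iff.1 h
  rw [heq_iff_eq] at h
  congr 1
  ext t
  exact hf (DFunLike.congr_fun h t)

lemma simpMap_image_simpIn {f : C(X, Y)} (hf : IsEmbedding f) {S : Set Y}
    (hS : S ⊆ Set.range f) : simpMap f '' simpIn (f ⁻¹' S) = simpIn S := by
  apply subset_antisymm
  · rintro _ ⟨p, hp, rfl⟩ t
    exact hp t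
  · rintro ⟨n, σ⟩ hσ
    let e := hf.toHomeomorph
    refine ⟨⟨n, ⟨fun t => e.symm ⟨σ t, hS (hσ t)⟩,
      e.symm.continuous.comp (σ.continuous.subtype_mk _)⟩⟩, ?_, ?_⟩
    · intro t
      have : f (e.symm ⟨σ t, hS (hσ t)⟩) = σ t :=
        congrArg Subtype.val (e.apply_symm_apply ⟨σ t, hS (hσ t)⟩)
      change f (e.symm ⟨σ t, hS (hσ t)⟩) ∈ S
      rw [this]
      exact hσ t
    · refine Sigma.ext rfl (heq_of_eq ?_)
      ext t
      exact congrArg Subtype.val (e.apply_symm_apply ⟨σ t, hS (hσ t)⟩)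

namespace Chain

lemma map_mem_image_iff {f : C(X, Y)} (hf : Function.Injective f) {s : Set (SingularSimplex X)}
    {c : Chain X} : map f c ∈ on (simpMap f '' s) ↔ c ∈ on s := by
  have h : (on s).map (map f) = on (simpMap f '' s) := lmapDomain_supported ℚ ℚ (simpMap f) s
  rw [← h]
  refine ⟨?_, fun h => Submodule.mem_map_of_mem h⟩
  rintro ⟨c', hc', e⟩
  rwa [← mapDomain_injective (simpMap_injective hf) e]

lemma exists_of_mem_image {f : C(X, Y)} {s : Set (SingularSimplex X)}
    {c : Chain Y} (hc : c ∈ on (simpMap f '' s)) : ∃ c' ∈ on s, map f c' = c := by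
  have h : (on s).map (map f) = on (simpMap f '' s) := lmapDomain_supported ℚ ℚ (simpMap f) s
  rwa [← h] at hc

end Chain

namespace Acyc

lemma map_iff {f : C(X, Y)} (hf : Function.Injective f) {s t : Set (SingularSimplex X)} {n : ℤ} :
    Acyc n (simpMap f '' s) (simpMap f '' t) ↔ Acyc n s t := by
  have hd : ∀ n, simpMap f '' t ∩ deg Y n = simpMap f '' (t ∩ deg X n) := fun n => by
    rw [Set.image_inter (simpMap_injective hf)]
    apply subset_antisymm
    · rintro _ ⟨⟨p, hp, rfl⟩, h2⟩
      exact ⟨⟨p, hp, rfl⟩, ⟨p, h2, rfl⟩⟩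
    · rintro _ ⟨h1, ⟨p, hp, rfl⟩⟩
      exact ⟨h1, hp⟩
  unfold Acyc
  rw [hd, hd]
  constructor
  · intro h c hc hdc
    obtain ⟨w, hw, hcw⟩ := h (map f c) ((map_mem_image_iff hf).2 hc)
      (by rwa [← map_d, map_mem_image_iff hf])
    obtain ⟨w', hw', rfl⟩ := exists_of_mem_image hw
    refine ⟨w', hw', ?_⟩
    rwa [← map_d, ← map_sub, map_mem_image_iff hf] at hcw
  · intro h c hc hdc
    obtain ⟨c', hc', rfl⟩ := exists_of_mem_image hc
    rw [← map_d, map_mem_image_iff hf] at hdc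
    obtain ⟨w, hw, hcw⟩ := h c' hc' hdc
    exact ⟨map f w, (map_mem_image_iff hf).2 hw, by
      rwa [← map_d, ← map_sub, map_mem_image_iff hf]⟩

/-- Transport along an embedding. -/
lemma embedding_iff {f : X → Y} (hf : IsEmbedding f) {S T : Set Y} (hS : S ⊆ Set.range f)
    (hT : T ⊆ Set.range f) {n : ℤ} :
    Acyc n (simpIn (f ⁻¹' S)) (simpIn (f ⁻¹' T)) ↔ Acyc n (simpIn S) (simpIn T) := by
  let g : C(X, Y) := ⟨f, hf.continuous⟩
  rw [← map_iff (f := g) hf.injective]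
  have h1 := simpMap_image_simpIn (f := g) hf hS
  have h2 := simpMap_image_simpIn (f := g) hf hT
  rw [← h1, ← h2]
  rfl

lemma homeomorph_iff (f : X ≃ₜ Y) {S T : Set Y} {n : ℤ} :
    Acyc n (simpIn (f ⁻¹' S)) (simpIn (f ⁻¹' T)) ↔ Acyc n (simpIn S) (simpIn T) :=
  embedding_iff f.isEmbedding (by simp) (by simp)

lemma of_real_deformation {S T : Set X} (F : ℝ → X → X)
    (hF : Continuous fun p : X × ℝ => F p.2 p.1) (h0 : ∀ x, F 0 x = x)
    (hS : ∀ s ∈ Set.Icc (0 : ℝ) 1, Set.MapsTo (F s) S S)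
    (hT : ∀ s ∈ Set.Icc (0 : ℝ) 1, Set.MapsTo (F s) T T) (h1 : Set.MapsTo (F 1) S T) (n : ℤ) :
    Acyc n (simpIn T) (simpIn S) := by
  have hI : ∀ e : Simplex 2, e.1 1 ∈ Set.Icc (0 : ℝ) 1 := fun e =>
    ⟨e.2.1 1, by have := e.2.2; rw [Fin.sum_univ_two] at this; linarith [e.2.1 0]⟩
  refine of_deformation (S := S) (T := T) ⟨fun p => F (p.2.1 1) p.1, ?_⟩ ?_ ?_ ?_ ?_ n
  · exact hF.comp (continuous_fst.prodMk
      ((continuous_apply 1).comp (continuous_subtype_val.comp continuous_snd)))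
  · intro x
    simp [vert, h0]
  · exact fun x hx e => hS _ (hI e) hx
  · exact fun x hx e => hT _ (hI e) hx
  · intro x hx
    simpa [vert] using h1 hx

/-- Mayer–Vietoris for two open sets whose inclusions are homology isomorphisms. -/
lemma suspension {A B : Set X} (hA : IsOpen A) (hB : IsOpen B)
    (h1 : ∀ n, Acyc n (simpIn A) (simpIn Set.univ)) (h2 : ∀ n, Acyc n (simpIn B) (simpIn Set.univ))
    {n : ℤ} :
    Acyc (n + 1) (simpIn (A ∪ B)) (simpIn Set.univ) ↔ Acyc n (simpIn (A ∩ B)) (simpIn Set.univ) := by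
  have h := fun n => excision_simpIn (S := A) (T := B) hA hB
    (Set.inter_eq_right.2 Set.subset_union_left) (Set.inter_eq_right.2 Set.subset_union_right)
    (n := n)
  rw [← left_iff (simpIn_mono Set.inter_subset_left) (simpIn_mono (Set.subset_univ A)) h1, h,
    shift_iff (simpIn_mono Set.subset_union_right) (simpIn_mono (Set.subset_univ _)) h2]

lemma empty_prod_real {n : ℤ} :
    Acyc n (simpIn (∅ : Set (X × ℝ))) (simpIn Set.univ) ↔
      Acyc n (simpIn (∅ : Set X)) (simpIn Set.univ) := by
  have hd : ∀ n, Acyc n (simpIn {p : X × ℝ | p.2 = 0}) (simpIn Set.univ) :=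
    of_real_deformation (fun s p => (p.1, (1 - s) * p.2)) (by fun_prop) (by simp)
      (fun s _ p _ => trivial) (fun s _ p hp => by simp_all) (fun p _ => by simp)
  rw [← left_iff (simpIn_mono (Set.empty_subset _)) (simpIn_mono (Set.subset_univ _)) hd]
  have hf : IsEmbedding fun x : X => (x, (0 : ℝ)) :=
    Function.LeftInverse.isEmbedding (f := Prod.fst) (fun x => rfl) continuous_fst (by fun_prop)
  rw [← embedding_iff hf (Set.empty_subset _) (by rintro ⟨x, t⟩ (rfl : t = 0); exact ⟨x, rfl⟩)]
  simp

lemma thom_pi (m : ℕ) {X : Type} [TopologicalSpace X] {n : ℤ} :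
    Acyc n (simpIn {p : X × (Fin m → ℝ) | p.2 ≠ 0}) (simpIn Set.univ) ↔
      Acyc (n - m) (simpIn (∅ : Set X)) (simpIn Set.univ) := by
  induction m generalizing X n with
  | zero =>
    have hf : IsEmbedding fun p : X × (Fin 0 → ℝ) => p.1 :=
      Function.LeftInverse.isEmbedding (f := fun x => (x, 0))
        (fun p => Prod.ext rfl (Subsingleton.elim _ _)) (by fun_prop) continuous_fst
    rw [← embedding_iff hf (Set.empty_subset _) (fun x _ => ⟨(x, 0), rfl⟩)]
    have : {p : X × (Fin 0 → ℝ) | p.2 ≠ 0} = ∅ :=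
      Set.eq_empty_of_forall_notMem fun p hp => hp (Subsingleton.elim _ _)
    rw [Set.preimage_empty, Set.preimage_univ, this, Nat.cast_zero, sub_zero]
  | succ m ih =>
    let E := X × (Fin (m + 1) → ℝ)
    have hne : IsOpen {p : E | Fin.tail p.2 ≠ 0} :=
      isOpen_ne_fun (continuous_pi fun i => (continuous_apply i.succ).comp continuous_snd)
        continuous_const
    have hc : Continuous fun p : E => p.2 0 := (continuous_apply 0).comp continuous_snd
    let A : Set E := {p | 0 < p.2 0} ∪ {p | Fin.tail p.2 ≠ 0}
    let B : Set E := {p | p.2 0 < 0} ∪ {p | Fin.tail p.2 ≠ 0}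
    have key : ∀ ε : ℝ, ε * ε = 1 → ∀ n,
        Acyc n (simpIn ({p : E | 0 < ε * p.2 0} ∪ {p | Fin.tail p.2 ≠ 0})) (simpIn Set.univ) := by
      intro ε hε
      refine of_real_deformation
        (fun s (p : E) => ((p.1, (1 - s) • p.2 + s • (Fin.cons ε 0 : Fin (m + 1) → ℝ)) : E))
        ((continuous_fst.comp continuous_fst).prodMk
          (((continuous_const.sub continuous_snd).smul (continuous_snd.comp continuous_fst)).add
            (continuous_snd.smul continuous_const))) (by simp) (fun s _ p _ => trivial) ?_ ?_
      · rintro s ⟨hs0, hs1⟩ p (hp | hp)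
        · left
          simp only [Set.mem_ofPred_eq, Pi.add_apply, Pi.smul_apply, smul_eq_mul, Fin.cons_zero]
            at hp ⊢
          have : ε * ((1 - s) * p.2 0 + s * ε) = (1 - s) * (ε * p.2 0) + s := by
            linear_combination s * hε
          rw [this]
          rcases hs1.eq_or_lt with rfl | h
          · simp
          · have := mul_pos (sub_pos.2 h) hp
            linarith
        · rcases hs1.eq_or_lt with rfl | h
          · left
            simp [hε]
          · right
            intro h0
            apply hp
            funext i
            have := congrFun h0 i
            simpa [Fin.tail, (sub_pos.2 h).ne'] using this
      · intro p _
        left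
        simp [hε]
    have hA : ∀ n, Acyc n (simpIn A) (simpIn Set.univ) := by simpa using key 1 (by norm_num)
    have hB : ∀ n, Acyc n (simpIn B) (simpIn Set.univ) := by simpa using key (-1) (by norm_num)
    have hU : A ∪ B = {p : E | p.2 ≠ 0} := by
      ext p
      simp only [A, B, Set.mem_union, Set.mem_ofPred_eq]
      constructor
      · rintro ((h | h) | (h | h)) h0 <;> simp [h0] at h
        · exact h rfl
        · exact h rfl
      · intro h
        by_contra! hn
        obtain ⟨⟨h1, h2⟩, h3, -⟩ := hn
        apply h
        funext i
        refine Fin.cases (le_antisymm h1 h3) (fun i => congrFun h2 i) i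
    have hI : A ∩ B = {p : E | Fin.tail p.2 ≠ 0} := by
      rw [← Set.inter_union_distrib_right]
      apply Set.union_eq_right.2
      rintro p ⟨h1, h2⟩
      exact (lt_asymm (show 0 < p.2 0 from h1) (show p.2 0 < 0 from h2)).elim
    have hsus := suspension (isOpen_lt continuous_const hc |>.union hne)
      (isOpen_lt hc continuous_const |>.union hne) hA hB (n := n - 1)
    rw [sub_add_cancel] at hsus
    change Acyc n (simpIn (A ∪ B)) _ ↔ Acyc (n - 1) (simpIn (A ∩ B)) _ at hsus
    rw [hU, hI] at hsus
    rw [hsus]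
    have hf : IsEmbedding fun p : (X × ℝ) × (Fin m → ℝ) =>
        ((p.1.1, Fin.cons p.1.2 p.2) : E) := by
      refine Function.LeftInverse.isEmbedding
        (f := fun p : E => ((p.1, p.2 0), Fin.tail p.2)) (fun p => ?_) ?_ ?_
      · simp
      · exact (continuous_fst.prodMk hc).prodMk
          (continuous_pi fun i => (continuous_apply i.succ).comp continuous_snd)
      · refine (by fun_prop : Continuous fun p : (X × ℝ) × (Fin m → ℝ) => p.1.1).prodMk
          (continuous_pi fun i => ?_)
        refine Fin.cases ?_ (fun i => ?_) i
        · simp only [Fin.cons_zero]; fun_prop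
        · simp only [Fin.cons_succ]; fun_prop
    have hr : ∀ S : Set E, S ⊆ Set.range fun p : (X × ℝ) × (Fin m → ℝ) =>
        ((p.1.1, Fin.cons p.1.2 p.2) : E) := fun S p _ =>
      ⟨((p.1, p.2 0), Fin.tail p.2), Prod.ext rfl (Fin.cons_self_tail p.2)⟩
    rw [← embedding_iff hf (hr _) (hr _)]
    have h := ih (X := X × ℝ) (n := n - 1)
    rw [empty_prod_real] at h
    have hp : (fun p : (X × ℝ) × (Fin m → ℝ) => ((p.1.1, Fin.cons p.1.2 p.2) : E)) ⁻¹'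
        {p | Fin.tail p.2 ≠ 0} = {p | p.2 ≠ 0} := by
      ext p
      simp [Fin.tail_cons]
    rw [hp, Set.preimage_univ, h]
    push_cast
    rw [show n - 1 - (m : ℤ) = n - (m + 1) by ring]

lemma thom (V : Type) [NormedAddCommGroup V] [NormedSpace ℝ V] [FiniteDimensional ℝ V] {n : ℤ} :
    Acyc n (simpIn {p : X × V | p.2 ≠ 0}) (simpIn Set.univ) ↔
      Acyc (n - Module.finrank ℝ V) (simpIn (∅ : Set X)) (simpIn Set.univ) := by
  have e : V ≃L[ℝ] (Fin (Module.finrank ℝ V) → ℝ) :=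
    ContinuousLinearEquiv.ofFinrankEq (by simp)
  rw [← thom_pi, ← homeomorph_iff ((Homeomorph.refl X).prodCongr e.toHomeomorph)]
  simp

end Acyc

end

end SingularChains

namespace SingularChains

open Finsupp Filter Topology Chain

instance : ConvexLike Unit where
  span _ := ContinuousMap.const _ ()
  span_vert _ _ := rfl
  span_affineMap _ _ _ := rfl

namespace Chain

lemma unit_exists_push (c : Chain Unit) : ∃ x, push (ContinuousMap.id Unit) x = c := by
  have : c ∈ LinearMap.range (push (ContinuousMap.id Unit)) :=
    map_mem_of_on (f := LinearMap.id) (s := Set.univ) (fun n σ _ =>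
      LinearMap.mem_range.2 ⟨.of fun _ : Fin n => (), by rw [push_of]; rfl⟩) (by simp)
  exact this

/-- Coning off simplices of the point. -/
noncomputable def unitCone : Chain Unit →ₗ[ℚ] Chain Unit :=
  lmapDomain ℚ ℚ fun p => ⟨p.1 + 1, ContinuousMap.const _ ()⟩

lemma unitCone_of {n : ℕ} (σ : C(Simplex n, Unit)) :
    unitCone (of σ) = of (ContinuousMap.const (Simplex (n + 1)) ()) := by
  simp [unitCone, of]

lemma unitCone_push (x : TupleChain Unit) :
    unitCone (push (ContinuousMap.id Unit) x) = push (ContinuousMap.id Unit) (.cone () x) := by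
  have : unitCone ∘ₗ push (ContinuousMap.id Unit) =
      push (ContinuousMap.id Unit) ∘ₗ TupleChain.cone () := TupleChain.hom_ext fun k v => by
    simp only [LinearMap.comp_apply, push_of, TupleChain.cone_of, unitCone_of]
    rfl
  exact LinearMap.congr_fun this x

lemma d_unitCone (c : Chain Unit) : d (unitCone c) = c - unitCone (d c) := by
  obtain ⟨x, rfl⟩ := unit_exists_push c
  rw [unitCone_push, d_push, TupleChain.d_cone, map_sub, d_push, unitCone_push]

end Chain

namespace Acyc

lemma unit_reduced (n : ℤ) : Acyc n ∅ (simpIn (Set.univ : Set Unit)) := by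
  intro c hc hdc
  rw [simpIn_univ, Set.univ_inter] at *
  refine ⟨unitCone c, map_mem_of_on (fun m σ (hσ : (m : ℤ) = n) => ?_) hc, ?_⟩
  · rw [unitCone_of]
    exact of_mem (show ((m + 1 : ℕ) : ℤ) = n + 1 by push_cast; rw [hσ])
  · have h0 : d c = 0 := by simpa [on] using hdc
    rw [d_unitCone, h0, map_zero, sub_zero, sub_self]
    exact Submodule.zero_mem _

lemma eq_zero_of_mem_simpIn_empty {X : Type} [TopologicalSpace X] {p : SingularSimplex X}
    (hp : p ∈ simpIn (∅ : Set X)) : p.1 = 0 := by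
  obtain ⟨n, σ⟩ := p
  cases n with
  | zero => rfl
  | succ n => exact (hp (vert 0)).elim

lemma empty_reduced_iff {X : Type} [TopologicalSpace X] {n : ℤ} :
    Acyc n ∅ (simpIn (∅ : Set X)) ↔ n ≠ 0 := by
  have hne : ∀ m : ℤ, m ≠ 0 → simpIn (∅ : Set X) ∩ deg X m = ∅ := fun m hm =>
    Set.eq_empty_of_forall_notMem fun p hp => hm (by
      have h2 : (p.1 : ℤ) = m := hp.2
      rw [← h2, eq_zero_of_mem_simpIn_empty hp.1]; rfl)
  constructor
  · rintro h rfl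
    let σ : C(Simplex 0, X) :=
      ⟨fun t => (by have := t.2.2; simp at this),
        continuous_iff_continuousAt.2 fun t => by have := t.2.2; simp at this⟩
    obtain ⟨w, hw, h⟩ := h (of σ)
      (of_mem ⟨fun t => by have := t.2.2; simp at this, rfl⟩) (by
        rw [d_of]; exact Submodule.zero_mem _)
    rw [hne _ (by norm_num)] at hw
    have hw0 : w = 0 := by simpa [on] using hw
    rw [hw0, map_zero, sub_zero] at h
    have h0 : of σ = 0 := by simpa [on] using h
    simp [of] at h0
  · intro hn c hc hdc
    rw [hne _ hn] at hc
    exact ⟨0, Submodule.zero_mem _, by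
      rw [map_zero, sub_zero]; exact hc⟩

lemma unit_iff {n : ℤ} : Acyc n (simpIn (∅ : Set Unit)) (simpIn Set.univ) ↔ n ≠ 1 := by
  have h := shift_iff (Set.empty_subset _) (simpIn_mono (Set.empty_subset Set.univ))
    unit_reduced (n := n - 1)
  rw [empty_reduced_iff, sub_add_cancel] at h
  rw [← h]
  omega

section
variable {V : Type} [NormedAddCommGroup V] [NormedSpace ℝ V]

lemma vectorSpace_iff {n : ℤ} : Acyc n (simpIn (∅ : Set V)) (simpIn Set.univ) ↔ n ≠ 1 := by
  have hd : ∀ n, Acyc n (simpIn {(0 : V)}) (simpIn Set.univ) :=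
    of_real_deformation (fun s v => (1 - s) • v) (by fun_prop) (by simp)
      (fun s _ p _ => trivial) (fun s _ p hp => by simp_all) (fun p _ => by simp)
  rw [← left_iff (simpIn_mono (Set.empty_subset _)) (simpIn_mono (Set.subset_univ _)) hd]
  have hf : IsEmbedding fun _ : Unit => (0 : V) :=
    Function.LeftInverse.isEmbedding (f := fun _ => ()) (fun x => rfl) continuous_const
      continuous_const
  rw [← embedding_iff hf (Set.empty_subset _) (by simp), ← unit_iff]
  have : (fun _ : Unit => (0 : V)) ⁻¹' {0} = Set.univ := by ext; simp
  rw [this, Set.preimage_empty]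

variable [FiniteDimensional ℝ V]

lemma punctured_relative_iff {n : ℤ} :
    Acyc n (simpIn {v : V | v ≠ 0}) (simpIn Set.univ) ↔ n ≠ Module.finrank ℝ V + 1 := by
  have hf : IsEmbedding fun p : Unit × V => p.2 :=
    Function.LeftInverse.isEmbedding (f := fun v => ((), v)) (fun p => rfl) (by fun_prop)
      continuous_snd
  rw [← embedding_iff hf (fun x _ => ⟨((), x), rfl⟩) (fun x _ => ⟨((), x), rfl⟩)]
  have h := thom (X := Unit) V (n := n)
  rw [unit_iff] at h
  refine h.trans ?_
  omega

lemma punctured {n : ℤ} (h1 : n ≠ 1) (h2 : n ≠ Module.finrank ℝ V) :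
    Acyc n (simpIn (∅ : Set V)) (simpIn {v : V | v ≠ 0}) :=
  of_trans_left (simpIn_mono (Set.empty_subset _)) (simpIn_mono (Set.subset_univ _))
    (vectorSpace_iff.2 h1) (punctured_relative_iff.2 (by omega))

lemma punctured_iff (hV : 2 ≤ Module.finrank ℝ V) {n : ℤ} :
    Acyc n (simpIn (∅ : Set V)) (simpIn {v : V | v ≠ 0}) ↔
      n ≠ 1 ∧ n ≠ Module.finrank ℝ V := by
  refine ⟨fun h => ⟨?_, ?_⟩, fun h => punctured h.1 h.2⟩
  · rintro rfl
    have := h.trans (simpIn_mono (Set.empty_subset _)) (simpIn_mono (Set.subset_univ _))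
      (punctured_relative_iff.2 (by omega))
    exact vectorSpace_iff.1 this rfl
  · rintro rfl
    have := of_trans_right (simpIn_mono (Set.empty_subset _)) (simpIn_mono (Set.subset_univ _)) h
      (vectorSpace_iff.2 (by omega))
    exact punctured_relative_iff.1 this rfl

end

end Acyc

end SingularChains

namespace SingularChains

open Finsupp Filter Topology Chain
open scoped ComplexOrder

/-- The nonzero matrices of rank one, as families of columns. -/
def rankOne (a b : ℕ) : Set (Fin b → Fin a → ℂ) :=
  {m | m ≠ 0 ∧ ∀ j j' i i', m j i * m j' i' = m j i' * m j' i}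

section
variable {a b : ℕ}

lemma isOpen_column_ne : IsOpen {m : Fin (b + 1) → Fin a → ℂ | m 0 ≠ 0} :=
  isOpen_ne_fun (continuous_apply 0) continuous_const

lemma isOpen_tail_ne : IsOpen {m : Fin (b + 1) → Fin a → ℂ | Fin.tail m ≠ 0} :=
  isOpen_ne_fun (continuous_pi fun i => continuous_apply i.succ) continuous_const

/-- The rank one matrices with nonzero first column, parametrized by this column and the
multiples giving the other columns. -/
def columnMap (a b : ℕ) (p : {v : Fin a → ℂ // v ≠ 0} × (Fin b → ℂ)) :
    Fin (b + 1) → Fin a → ℂ :=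
  Fin.cons p.1.1 fun j => p.2 j • p.1.1

lemma columnMap_mem (p : {v : Fin a → ℂ // v ≠ 0} × (Fin b → ℂ)) :
    columnMap a b p ∈ rankOne a (b + 1) ∩ {m | m 0 ≠ 0} := by
  refine ⟨⟨fun h => p.1.2 ?_, fun j j' i i' => ?_⟩, p.1.2⟩
  · exact congrFun h 0
  · refine Fin.cases ?_ (fun j => ?_) j <;> refine Fin.cases ?_ (fun j' => ?_) j' <;>
      simp [columnMap] <;> ring

lemma range_columnMap : Set.range (columnMap a b) = rankOne a (b + 1) ∩ {m | m 0 ≠ 0} := by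
  apply subset_antisymm
  · rintro _ ⟨p, rfl⟩
    exact columnMap_mem p
  · rintro m ⟨⟨-, hm⟩, h0⟩
    obtain ⟨i₀, hi₀⟩ := Function.ne_iff.1 (show m 0 ≠ 0 from h0)
    refine ⟨(⟨m 0, h0⟩, fun j => m j.succ i₀ / m 0 i₀), ?_⟩
    funext j
    refine Fin.cases rfl (fun j => ?_) j
    funext i
    have := hm 0 j.succ i i₀
    simp only [Pi.zero_apply] at hi₀
    simp only [columnMap, Fin.cons_succ, Pi.smul_apply, smul_eq_mul]
    rw [div_mul_eq_mul_div, div_eq_iff hi₀]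
    linear_combination this

lemma isEmbedding_columnMap : IsEmbedding (columnMap a b) := by
  let U : Set (Fin (b + 1) → Fin a → ℂ) := {m | m 0 ≠ 0}
  have hne : ∀ v : Fin a → ℂ, v ≠ 0 → star v ⬝ᵥ v ≠ 0 := fun v hv h =>
    hv (dotProduct_star_self_eq_zero.1 h)
  have h : IsEmbedding fun p : {v : Fin a → ℂ // v ≠ 0} × (Fin b → ℂ) =>
      (⟨columnMap a b p, (columnMap_mem p).2⟩ : U) := by
    refine Function.LeftInverse.isEmbedding (f := fun m : U =>
      ((⟨m.1 0, m.2⟩ : {v : Fin a → ℂ // v ≠ 0}),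
        fun j : Fin b => (star (m.1 0) ⬝ᵥ m.1 j.succ) / (star (m.1 0) ⬝ᵥ m.1 0))) ?_ ?_ ?_
    · intro p
      refine Prod.ext rfl (funext fun j => ?_)
      simp only [columnMap, Fin.cons_zero, Fin.cons_succ, dotProduct_smul, smul_eq_mul]
      exact mul_div_cancel_right₀ _ (hne _ p.1.2)
    · have hc : ∀ j, Continuous fun m : U => m.1 j := fun j =>
        (continuous_apply j).comp continuous_subtype_val
      refine (Continuous.subtype_mk (hc 0) _).prodMk (continuous_pi fun j => ?_)
      exact ((hc 0).star.dotProduct (hc _)).div ((hc 0).star.dotProduct (hc 0))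
        fun m => hne _ m.2
    · refine Continuous.subtype_mk (continuous_pi fun j => ?_) _
      refine Fin.cases ?_ (fun j => ?_) j
      · exact continuous_subtype_val.comp continuous_fst
      · exact ((continuous_apply j).comp continuous_snd).smul
          (continuous_subtype_val.comp continuous_fst)
  exact IsEmbedding.subtypeVal.comp h

namespace Acyc

lemma rankOne_relative_iff (ha : 1 ≤ a) {n : ℤ} :
    Acyc n (simpIn (rankOne a (b + 1) ∩ {m | Fin.tail m ≠ 0})) (simpIn (rankOne a (b + 1))) ↔
      n ≠ 2 * b + 1 ∧ n ≠ 2 * a + 2 * b := by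
  have hU : rankOne a (b + 1) ∩ {m | m 0 ≠ 0} ∪ rankOne a (b + 1) ∩ {m | Fin.tail m ≠ 0} =
      rankOne a (b + 1) := by
    rw [← Set.inter_union_distrib_left]
    refine Set.inter_eq_left.2 fun m hm => ?_
    by_contra! h
    simp only [Set.mem_union, Set.mem_ofPred_eq, not_or, not_not] at h
    exact hm.1 (funext fun j => Fin.cases h.1 (fun j => congrFun h.2 j) j)
  have hex := excision_simpIn (S := rankOne a (b + 1) ∩ {m | m 0 ≠ 0})
    (T := rankOne a (b + 1) ∩ {m | Fin.tail m ≠ 0}) isOpen_column_ne isOpen_tail_ne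
    (by rw [hU]) (by rw [hU]) (n := n)
  rw [hU] at hex
  rw [← hex, ← embedding_iff isEmbedding_columnMap
    (Set.inter_subset_left.trans range_columnMap.ge) range_columnMap.ge]
  have h1 : columnMap a b ⁻¹' (rankOne a (b + 1) ∩ {m | m 0 ≠ 0}) = Set.univ :=
    Set.eq_univ_of_forall columnMap_mem
  have h2 : columnMap a b ⁻¹' (rankOne a (b + 1) ∩ {m | m 0 ≠ 0} ∩
      (rankOne a (b + 1) ∩ {m | Fin.tail m ≠ 0})) = {p | p.2 ≠ 0} := by
    ext p
    have hp := columnMap_mem p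
    have : Fin.tail (columnMap a b p) ≠ 0 ↔ p.2 ≠ 0 := by
      rw [not_iff_not]
      simp only [columnMap, Fin.tail_cons]
      constructor
      · intro h
        funext j
        exact (smul_eq_zero.1 (congrFun h j)).resolve_right p.1.2
      · rintro h
        funext j
        simp [h]
    exact ⟨fun h => this.1 h.2.2, fun h => ⟨hp, hp.1, this.2 h⟩⟩
  rw [h1, h2, thom, ← Set.preimage_univ (f := Subtype.val)]
  have h3 := embedding_iff (n := n - Module.finrank ℝ (Fin b → ℂ))
    (IsEmbedding.subtypeVal (p := fun v : Fin a → ℂ => v ≠ 0)) (S := ∅) (T := {v | v ≠ 0})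
    (Set.empty_subset _) (by simp)
  have h4 : (Subtype.val : {v : Fin a → ℂ // v ≠ 0} → _) ⁻¹' {v | v ≠ 0} = Set.univ :=
    Set.eq_univ_of_forall fun v => v.2
  have hfr : ∀ k : ℕ, Module.finrank ℝ (Fin k → ℂ) = 2 * k := fun k => by
    rw [Module.finrank_pi_fintype]
    simp [mul_comm]
  rw [h4, Set.preimage_empty, punctured_iff (by rw [hfr]; omega), hfr, hfr] at h3
  rw [hfr, Set.preimage_univ]
  refine h3.trans ?_
  push_cast
  omega

lemma rankOne_tail_iff {n : ℤ} :
    Acyc n (simpIn ∅) (simpIn (rankOne a (b + 1) ∩ {m | Fin.tail m ≠ 0})) ↔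
      Acyc n (simpIn ∅) (simpIn (rankOne a b)) := by
  let V' : Set (Fin (b + 1) → Fin a → ℂ) :=
    {m | m ∈ rankOne a (b + 1) ∩ {m | Fin.tail m ≠ 0} ∧ m 0 = 0}
  have hmem : ∀ s : ℝ, ∀ m ∈ rankOne a (b + 1) ∩ {m | Fin.tail m ≠ 0},
      (Fin.cons ((1 - s) • m 0) (Fin.tail m) : Fin (b + 1) → Fin a → ℂ) ∈
        rankOne a (b + 1) ∩ {m | Fin.tail m ≠ 0} := by
    rintro s m ⟨⟨-, hm⟩, ht⟩
    refine ⟨⟨fun h => ht ?_, fun j j' i i' => ?_⟩, ?_⟩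
    · rw [← Fin.tail_cons (α := fun _ => Fin a → ℂ) ((1 - s) • m 0) (Fin.tail m), h]
      rfl
    · refine Fin.cases ?_ (fun j => ?_) j <;> refine Fin.cases ?_ (fun j' => ?_) j' <;>
        simp only [Fin.cons_zero, Fin.cons_succ, Pi.smul_apply, Complex.real_smul, Fin.tail]
      · ring
      · rw [mul_assoc, mul_assoc, hm]
      · rw [mul_left_comm, hm]; ring
      · exact hm _ _ _ _
    · exact ht
  have hd : ∀ n, Acyc n (simpIn V') (simpIn (rankOne a (b + 1) ∩ {m | Fin.tail m ≠ 0})) := by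
    refine of_real_deformation (fun s m => Fin.cons ((1 - s) • m 0) (Fin.tail m)) ?_ ?_ ?_ ?_ ?_
    · refine continuous_pi fun j => ?_
      refine Fin.cases ?_ (fun j => ?_) j
      · simp only [Fin.cons_zero]; fun_prop
      · simp only [Fin.cons_succ, Fin.tail]; fun_prop
    · intro m; simp
    · exact fun s _ m hm => hmem s m hm
    · exact fun s _ m hm => ⟨hmem s m hm.1, by simp [hm.2]⟩
    · exact fun m hm => ⟨hmem 1 m hm, by simp⟩
  rw [← left_iff (simpIn_mono (Set.empty_subset _)) (simpIn_mono fun m hm => hm.1) hd]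
  have hf : IsEmbedding fun m : Fin b → Fin a → ℂ => (Fin.cons 0 m : Fin (b + 1) → Fin a → ℂ) := by
    refine Function.LeftInverse.isEmbedding (f := Fin.tail) (fun m => Fin.tail_cons _ _)
      (continuous_pi fun i : Fin b => continuous_apply (A := fun _ => Fin a → ℂ) i.succ)
      (continuous_pi fun j => ?_)
    refine Fin.cases ?_ (fun j => ?_) j
    · exact continuous_const
    · exact continuous_apply j
  rw [← embedding_iff hf (Set.empty_subset _)
    (fun m hm => ⟨Fin.tail m, by rw [← show m 0 = 0 from hm.2]; exact Fin.cons_self_tail m⟩)]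
  have : (fun m : Fin b → Fin a → ℂ => (Fin.cons 0 m : Fin (b + 1) → Fin a → ℂ)) ⁻¹' V' =
      rankOne a b := by
    ext m
    constructor
    · rintro ⟨⟨⟨-, h1⟩, h2⟩, -⟩
      exact ⟨h2, fun j j' i i' => h1 j.succ j'.succ i i'⟩
    · rintro ⟨h1, h2⟩
      refine ⟨⟨⟨fun h => h1 ?_, fun j j' i i' => ?_⟩, h1⟩, rfl⟩
      · exact congrArg Fin.tail h
      · refine Fin.cases ?_ (fun j => ?_) j <;> refine Fin.cases ?_ (fun j' => ?_) j' <;>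
          simp [h2 _ _ i i']
  rw [this, Set.preimage_empty]

/-- The homology of the space of rank one matrices. -/
lemma rankOne_iff (ha : 1 ≤ a) (hb : b ≤ a) {n : ℤ} :
    Acyc n (simpIn ∅) (simpIn (rankOne a b)) ↔
      ¬ (n % 2 = 1 ∧ 1 ≤ n ∧ n ≤ 2 * b - 1 ∨ n % 2 = 0 ∧ 2 * a ≤ n ∧ n ≤ 2 * a + 2 * b - 2) := by
  induction b generalizing n with
  | zero =>
    have : rankOne a 0 = ∅ := Set.eq_empty_of_forall_notMem fun m hm =>
      hm.1 (Subsingleton.elim _ _)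
    rw [this]
    exact iff_of_true (refl n _) (by omega)
  | succ b ih =>
    have hV : ∀ {n : ℤ}, _ := fun {n} => (rankOne_tail_iff (a := a) (b := b) (n := n)).trans
      (ih (by omega))
    have hR := fun {n : ℤ} => rankOne_relative_iff (a := a) (b := b) ha (n := n)
    have i1 := simpIn_mono (Set.empty_subset (rankOne a (b + 1) ∩ {m | Fin.tail m ≠ 0}))
    have i2 := simpIn_mono
      (Set.inter_subset_left (s := rankOne a (b + 1)) (t := {m | Fin.tail m ≠ 0}))
    push_cast
    constructor
    · intro h hn
      by_cases hb : n % 2 = 1 ∧ 1 ≤ n ∧ n ≤ 2 * b - 1 ∨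
          n % 2 = 0 ∧ 2 * a ≤ n ∧ n ≤ 2 * a + 2 * b - 2
      · exact hV.1 (of_trans_left i1 i2 h (hR.2 (by omega))) hb
      · have h' := hR.1 (of_trans_right (n := n - 1) i1 i2 (hV.2 (by omega)) (by simpa using h))
        omega
    · intro hn
      exact trans i1 i2 (hV.2 (by omega)) (hR.2 (by omega))

end Acyc

end

end SingularChains

namespace SingularChains

open Finsupp

section
variable {C : Type*} [AddCommGroup C] [Module ℚ C]

/-- Vanishing of the homology of the pair `(B, A)` of subcomplexes of an ungraded complex. -/
def RelAcyclic (δ : C →ₗ[ℚ] C) (A B : Submodule ℚ C) : Prop :=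
  ∀ c ∈ B, δ c ∈ A → ∃ w ∈ B, c - δ w ∈ A

namespace RelAcyclic
variable {δ : C →ₗ[ℚ] C} {A B E : Submodule ℚ C}

lemma trans (hδ : ∀ c, δ (δ c) = 0) (hAB : A ≤ B) (hBE : B ≤ E) (h1 : RelAcyclic δ A B)
    (h2 : RelAcyclic δ B E) : RelAcyclic δ A E := by
  intro c hc hdc
  obtain ⟨w, hw, hcw⟩ := h2 c hc (hAB hdc)
  obtain ⟨w', hw', hcw'⟩ := h1 _ hcw (by rwa [map_sub, hδ, sub_zero])
  exact ⟨w + w', E.add_mem hw (hBE hw'), by rwa [map_add, ← sub_sub]⟩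

lemma of_trans_right (hδ : ∀ c, δ (δ c) = 0) (hAB : A ≤ B) (hBE : B ≤ E)
    (h1 : RelAcyclic δ A B) (h2 : RelAcyclic δ A E) : RelAcyclic δ B E := by
  intro c hc hdc
  obtain ⟨w, hw, hcw⟩ := h1 (δ c) hdc (by rw [hδ]; exact A.zero_mem)
  obtain ⟨v, hv, hcv⟩ := h2 (c - w) (E.sub_mem hc (hBE hw)) (by rwa [map_sub])
  refine ⟨v, hv, ?_⟩
  have := B.add_mem (hAB hcv) hw
  rwa [show c - w - δ v + w = c - δ v by abel] at this

lemma excision (hA : ∀ c ∈ A, δ c ∈ A) (hB : ∀ c ∈ B, δ c ∈ B) (h : RelAcyclic δ (A ⊓ B) A) :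
    RelAcyclic δ B (A ⊔ B) := by
  intro c hc hdc
  obtain ⟨p, hp, q, hq, rfl⟩ := Submodule.mem_sup.1 hc
  rw [map_add] at hdc
  obtain ⟨w, hw, hpw⟩ := h p hp ⟨hA p hp, by simpa using B.sub_mem hdc (hB q hq)⟩
  refine ⟨w, Submodule.mem_sup_left hw, ?_⟩
  have := B.add_mem hpw.2 hq
  rwa [show p - δ w + q = p + q - δ w by abel] at this

end RelAcyclic

end

section
variable {X Y : Type} [TopologicalSpace X] [TopologicalSpace Y]

namespace Chain

/-- The component of a chain on simplices with `n` vertices. -/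
noncomputable def component (n : ℤ) : Chain X →ₗ[ℚ] Chain X := by
  classical
  exact linearCombination ℚ fun p => if (p.1 : ℤ) = n then single p 1 else 0

lemma component_of (n : ℤ) {k : ℕ} (σ : C(Simplex k, X)) :
    component n (of σ) = if (k : ℤ) = n then of σ else 0 := by
  classical
  simp [component, of]

lemma component_mem_on (n : ℤ) {s : Set (SingularSimplex X)} {c : Chain X} (hc : c ∈ on s) :
    component n c ∈ on (s ∩ deg X n) :=
  map_mem_of_on (fun k σ hσ => by
    rw [component_of]
    split_ifs with h
    · exact of_mem ⟨hσ, h⟩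
    · exact Submodule.zero_mem _) hc

lemma component_of_mem_deg {n : ℤ} {c : Chain X} (hc : c ∈ on (deg X n)) :
    component n c = c := by
  have : c ∈ LinearMap.ker (component n - LinearMap.id : Chain X →ₗ[ℚ] Chain X) := by
    have h := map_mem_of_on (f := (LinearMap.id : Chain X →ₗ[ℚ] Chain X)) (s := deg X n)
      (N := LinearMap.ker (component n - LinearMap.id : Chain X →ₗ[ℚ] Chain X))
      (fun k σ (hσ : (k : ℤ) = n) => by
        simp only [LinearMap.id_apply, LinearMap.mem_ker, LinearMap.sub_apply]
        rw [component_of, if_pos hσ, sub_self]) hc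
    exact h
  exact sub_eq_zero.1 (LinearMap.mem_ker.1 this)

lemma component_of_mem_deg_ne {n m : ℤ} (hnm : m ≠ n) {c : Chain X} (hc : c ∈ on (deg X m)) :
    component n c = 0 := by
  have h := map_mem_of_on (f := (component n : Chain X →ₗ[ℚ] Chain X)) (s := deg X m) (N := ⊥)
    (fun k σ (hσ : (k : ℤ) = m) => by
      rw [component_of, if_neg (hσ ▸ hnm)]; exact Submodule.zero_mem _) hc
  simpa using h

lemma d_component (n : ℤ) (c : Chain X) : d (component (n + 1) c) = component n (d c) := by
  have : d ∘ₗ component (n + 1) = (component n ∘ₗ d : Chain X →ₗ[ℚ] Chain X) :=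
    hom_ext fun k σ => by
      have hk : d (of σ) ∈ on (deg X ((k : ℤ) - 1)) := isLocal_d.map_deg (of_mem rfl)
      simp only [LinearMap.comp_apply, component_of]
      split_ifs with h
      · rw [component_of_mem_deg]
        rwa [h, add_sub_cancel_right] at hk
      · rw [map_zero, component_of_mem_deg_ne (by omega) hk]
  exact LinearMap.congr_fun this c

lemma exists_sum_component (c : Chain X) :
    ∃ K : ℕ, c = ∑ n ∈ Finset.range K, component (n : ℤ) c := by
  classical
  refine ⟨c.support.sup (fun p => p.1) + 1, ?_⟩
  have : c ∈ on {p : SingularSimplex X | p.1 < c.support.sup (fun p => p.1) + 1} := by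
    intro p hp
    exact Nat.lt_succ_of_le (Finset.le_sup (f := fun p : SingularSimplex X => p.1) hp)
  generalize c.support.sup (fun p => p.1) + 1 = K at this
  have h := map_mem_of_on (f := (LinearMap.id - ∑ n ∈ Finset.range K, component (n : ℤ) :
      Chain X →ₗ[ℚ] Chain X)) (N := ⊥) (fun k σ (hσ : k < K) => by
    rw [Submodule.mem_bot, LinearMap.sub_apply, LinearMap.sum_apply]
    simp [component_of, hσ]) this
  rw [Submodule.mem_bot, LinearMap.sub_apply, LinearMap.sum_apply] at h
  exact sub_eq_zero.1 h

end Chain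

open Chain

lemma Acyc.relAcyclic {s t : Set (SingularSimplex X)} (h : ∀ n, Acyc n s t) :
    RelAcyclic (d : Chain X →ₗ[ℚ] Chain X) (on s) (on t) := by
  intro c hc hdc
  have h' : ∀ n : ℕ, ∃ w ∈ on t, component (n : ℤ) c - d w ∈ on s := fun n => by
    obtain ⟨w, hw, hcw⟩ := h n (component n c) (component_mem_on _ hc) (by
      have := d_component ((n : ℤ) - 1) c
      rw [sub_add_cancel] at this
      rw [this]
      exact (mem_on_inter.1 (component_mem_on _ hdc)).1)
    exact ⟨w, (mem_on_inter.1 hw).1, hcw⟩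
  choose w hw hcw using h'
  obtain ⟨K, hK⟩ := exists_sum_component c
  refine ⟨∑ n ∈ Finset.range K, w n, Submodule.sum_mem _ fun n _ => hw n, ?_⟩
  rw [hK, map_sum, ← Finset.sum_sub_distrib]
  exact Submodule.sum_mem _ fun n _ => hcw n

/-- The differential of the mapping cone of an endomorphism of the singular chains. -/
noncomputable def coneD (P : C(X, X)) : Chain X × Chain X →ₗ[ℚ] Chain X × Chain X :=
  (d ∘ₗ LinearMap.fst ℚ _ _).prod (map P ∘ₗ LinearMap.fst ℚ _ _ - d ∘ₗ LinearMap.snd ℚ _ _)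

lemma coneD_apply (P : C(X, X)) (c : Chain X × Chain X) :
    coneD P c = (d c.1, map P c.1 - d c.2) := rfl

lemma coneD_coneD (P : C(X, X)) (c : Chain X × Chain X) : coneD P (coneD P c) = 0 := by
  simp [coneD_apply, d_d, map_d]

/-- The chains of the mapping cone supported in a set of simplices. -/
noncomputable def coneOn (s : Set (SingularSimplex X)) : Submodule ℚ (Chain X × Chain X) :=
  (on s).prod (on s)

lemma coneOn_mono {s t : Set (SingularSimplex X)} (h : s ⊆ t) : coneOn s ≤ coneOn t :=
  Submodule.prod_mono (supported_mono h) (supported_mono h)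

lemma coneOn_inter (s t : Set (SingularSimplex X)) : coneOn (s ∩ t) = coneOn s ⊓ coneOn t := by
  rw [coneOn, coneOn, coneOn, Submodule.prod_inf_prod, ← supported_inter]

lemma coneOn_union (s t : Set (SingularSimplex X)) : coneOn (s ∪ t) = coneOn s ⊔ coneOn t := by
  rw [coneOn, coneOn, coneOn, Submodule.prod_sup_prod, ← supported_union]

/-- The map induced by `P` on the homology of the pair `(t, s)` is an isomorphism. -/
def PairIso (P : C(X, X)) (s t : Set (SingularSimplex X)) : Prop :=
  RelAcyclic (coneD P) (coneOn s) (coneOn t)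

lemma PairIso.of_acyc {P : C(X, X)} {s t : Set (SingularSimplex X)} (h : ∀ n, Acyc n s t)
    (hs : ∀ c ∈ on s, map P c ∈ on s) (ht : ∀ c ∈ on t, map P c ∈ on t) : PairIso P s t := by
  rintro ⟨z, w⟩ ⟨hz, hw⟩ ⟨hdz, hzw⟩
  have H := Acyc.relAcyclic h
  simp only [coneD_apply] at hdz hzw
  obtain ⟨u, hu, hzu⟩ := H z hz hdz
  obtain ⟨v, hv, hv'⟩ := H (map P u - w) (Submodule.sub_mem _ (ht u hu) hw) (by
    have := Submodule.sub_mem _ hzw (hs _ hzu)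
    rwa [map_sub, sub_sub_sub_cancel_left, map_d, ← map_sub] at this)
  refine ⟨(u, v), ⟨hu, hv⟩, hzu, ?_⟩
  have := Submodule.neg_mem _ hv'
  rwa [show -(map P u - w - d v) = w - (map P u - d v) by abel] at this

lemma coneD_mem {P : C(X, X)} {S : Set X} (hS : Set.MapsTo P S S) :
    ∀ c ∈ coneOn (simpIn S), coneD P c ∈ coneOn (simpIn S) := fun _ hc =>
  ⟨isLocal_d.map_simpIn hc.1,
    Submodule.sub_mem _ (map_mem_simpIn hS hc.1) (isLocal_d.map_simpIn hc.2)⟩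

/-- Mayer–Vietoris. -/
lemma PairIso.union {P : C(X, X)} {S O₁ O₂ : Set X} (h₁ : IsOpen O₁) (h₂ : IsOpen O₂)
    (hS : S ⊆ O₁ ∪ O₂) (hP₁ : Set.MapsTo P (S ∩ O₁) (S ∩ O₁)) (hP₂ : Set.MapsTo P (S ∩ O₂) (S ∩ O₂))
    (H₁ : PairIso P ∅ (simpIn (S ∩ O₁))) (H₂ : PairIso P ∅ (simpIn (S ∩ O₂)))
    (H₁₂ : PairIso P ∅ (simpIn (S ∩ O₁ ∩ (S ∩ O₂)))) : PairIso P ∅ (simpIn S) := by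
  have hD := coneD_coneD P
  have hPS : Set.MapsTo P S S := fun x hx =>
    (hS hx).elim (fun h => (hP₁ ⟨hx, h⟩).1) fun h => (hP₂ ⟨hx, h⟩).1
  have h := RelAcyclic.of_trans_right hD (coneOn_mono (Set.empty_subset _))
    (coneOn_mono (simpIn_mono Set.inter_subset_left)) H₁₂ H₁
  rw [simpIn_inter, coneOn_inter] at h
  have h := RelAcyclic.excision (coneD_mem hP₁) (coneD_mem hP₂) h
  rw [← coneOn_union] at h
  have h := RelAcyclic.trans hD (coneOn_mono (Set.empty_subset _))
    (coneOn_mono Set.subset_union_right) H₂ h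
  refine RelAcyclic.trans hD (coneOn_mono (Set.empty_subset _)) (coneOn_mono
    (Set.union_subset (simpIn_mono Set.inter_subset_left) (simpIn_mono Set.inter_subset_left))) h ?_
  refine PairIso.of_acyc (Acyc.small h₁ h₂ hS) ?_ (fun c hc => map_mem_simpIn hPS hc)
  intro c hc
  rw [on, supported_union, Submodule.mem_sup] at hc
  obtain ⟨p, hp, q, hq, rfl⟩ := hc
  rw [on, supported_union, Submodule.mem_sup]
  exact ⟨_, map_mem_simpIn hP₁ hp, _, map_mem_simpIn hP₂ hq, (map_add _ _ _).symm⟩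

lemma PairIso.empty (P : C(X, X)) : PairIso P ∅ (simpIn ∅) := by
  have hd : ∀ c ∈ on (simpIn (∅ : Set X)), d c = 0 := fun c hc => by
    have := map_mem_of_on (f := (d : Chain X →ₗ[ℚ] Chain X)) (N := ⊥) (fun n σ hσ => by
      cases n with
      | zero => rw [d_of]; rfl
      | succ n => exact (hσ (vert 0)).elim) hc
    simpa using this
  have hP : ∀ c ∈ on (simpIn (∅ : Set X)), map P c = c := fun c hc => by
    have := map_mem_of_on (f := map P - LinearMap.id) (N := ⊥) (fun n σ hσ => by
      cases n with
      | zero =>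
        rw [LinearMap.sub_apply, map_of, LinearMap.id_apply]
        have : P.comp σ = σ := ContinuousMap.ext fun t => (hσ t).elim
        rw [this, sub_self]; rfl
      | succ n => exact (hσ (vert 0)).elim) hc
    rw [Submodule.mem_bot, LinearMap.sub_apply] at this
    exact sub_eq_zero.1 this
  rintro ⟨z, w⟩ ⟨hz, hw⟩ ⟨_, hzw⟩
  simp only [coneD_apply] at hz hw hzw
  rw [hP z hz, hd w hw, sub_zero] at hzw
  refine ⟨(w, 0), ⟨hw, Submodule.zero_mem _⟩, ?_, ?_⟩
  · simpa [coneD_apply, hd w hw] using hzw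
  · simp [coneD_apply, hP w hw]

/-- The transfer argument for a covering-like map `P` on `T` with a deck group acting by maps
homotopic to the identity. -/
lemma PairIso.of_transfer {P : C(X, X)} {T : Set X} (hP : Set.MapsTo P T T)
    {G : Type} [Group G] [Fintype G] (h : G → C(X, X)) (hT : ∀ g, Set.MapsTo (h g) T T)
    (hmul : ∀ g g', (h g).comp (h g') = h (g * g')) (hPh : ∀ g, P.comp (h g) = P)
    (lift : ∀ (n : ℕ) (σ : C(Simplex n, X)), ⟨n, σ⟩ ∈ simpIn T →
      ∃ ρ : C(Simplex n, X), ⟨n, ρ⟩ ∈ simpIn T ∧ P.comp ρ = σ)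
    (unique : ∀ (n : ℕ) (α β : C(Simplex n, X)), ⟨n, α⟩ ∈ simpIn T → ⟨n, β⟩ ∈ simpIn T →
      P.comp α = P.comp β → ∃ g, β = (h g).comp α)
    (K : G → C(X × Simplex 2, X)) (hK : ∀ g, ∀ x ∈ T, ∀ e, K g (x, e) ∈ T)
    (hK0 : ∀ g x, K g (x, vert 0) = x) (hK1 : ∀ g x, K g (x, vert 1) = h g x) :
    PairIso P ∅ (simpIn T) := by
  classical
  choose! ρ hρT hρ using lift
  let S : Chain X →ₗ[ℚ] Chain X := ∑ g, map (h g)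
  have hS_apply : ∀ c, S c = ∑ g, map (h g) c := fun c => LinearMap.sum_apply _ _ _
  let τ : Chain X →ₗ[ℚ] Chain X := linearCombination ℚ fun p =>
    if p ∈ simpIn T then S (of (ρ p.1 p.2)) else 0
  have hτ_of : ∀ (n : ℕ) (σ : C(Simplex n, X)), ⟨n, σ⟩ ∈ simpIn T → τ (of σ) = S (of (ρ n σ)) :=
    fun n σ hσ => by simp [τ, of, hσ]
  have hSh : ∀ g c, S (map (h g) c) = S c := fun g c => by
    rw [hS_apply, hS_apply]
    simp only [map_map, hmul]
    exact Fintype.sum_equiv (Equiv.mulRight g) _ _ fun _ => rfl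
  have hτ : ∀ (n : ℕ) (α : C(Simplex n, X)), ⟨n, α⟩ ∈ simpIn T → τ (of (P.comp α)) = S (of α) := by
    intro n α hα
    have hPα : (⟨n, P.comp α⟩ : SingularSimplex X) ∈ simpIn T := fun t => hP (hα t)
    rw [hτ_of _ _ hPα]
    obtain ⟨g, hg⟩ := unique n α (ρ n (P.comp α)) hα (hρT _ _ hPα) (hρ _ _ hPα).symm
    rw [hg, ← map_of, hSh]
  have hτ_push : ∀ (n : ℕ) (α : C(Simplex n, X)), ⟨n, α⟩ ∈ simpIn T →
      ∀ x, τ (push (P.comp α) x) = S (push α x) := by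
    intro n α hα x
    have : τ ∘ₗ push (P.comp α) = S ∘ₗ push α := TupleChain.hom_ext fun k v => by
      simp only [LinearMap.comp_apply, push_of, ContinuousMap.comp_assoc]
      exact hτ k _ fun t => hα _
    exact LinearMap.congr_fun this x
  have hdS : ∀ c, d (S c) = S (d c) := fun c => by simp [hS_apply, map_d]
  have hS_mem : ∀ c ∈ on (simpIn T), S c ∈ on (simpIn T) := fun c hc => by
    rw [hS_apply]
    exact Submodule.sum_mem _ fun g _ => map_mem_simpIn (hT g) hc
  have hτ_mem : ∀ c ∈ on (simpIn T), τ c ∈ on (simpIn T) := fun c hc =>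
    map_mem_of_on (fun n σ hσ => by
      rw [hτ_of n σ hσ]; exact hS_mem _ (of_mem (hρT n σ hσ))) hc
  have ext : ∀ {f g : Chain X →ₗ[ℚ] Chain X},
      (∀ (n : ℕ) (σ : C(Simplex n, X)), ⟨n, σ⟩ ∈ simpIn T → f (of σ) = g (of σ)) →
      ∀ c ∈ on (simpIn T), f c = g c := by
    intro f g hfg c hc
    have := map_mem_of_on (f := f - g) (N := ⊥) (fun n σ hσ => by
      rw [LinearMap.sub_apply, hfg n σ hσ, sub_self]; rfl) hc
    rw [Submodule.mem_bot, LinearMap.sub_apply] at this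
    exact sub_eq_zero.1 this
  have hτd : ∀ c ∈ on (simpIn T), τ (d c) = d (τ c) :=
    ext (f := τ ∘ₗ d) (g := d ∘ₗ τ) fun n σ hσ => by
      simp only [LinearMap.comp_apply]
      rw [hτ_of n σ hσ, hdS, of_eq_push (ρ n σ), d_push, ← hτ_push n _ (hρT n σ hσ), hρ n σ hσ,
        ← d_push, ← of_eq_push]
  have hτP : ∀ c ∈ on (simpIn T), τ (map P c) = S c :=
    ext (f := τ ∘ₗ map P) (g := S) fun n σ hσ => by
      rw [LinearMap.comp_apply, map_of, hτ n σ hσ]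
  have hPτ : ∀ c ∈ on (simpIn T), map P (τ c) = (Fintype.card G : ℚ) • c :=
    ext (f := map P ∘ₗ τ) (g := (Fintype.card G : ℚ) • LinearMap.id) fun n σ hσ => by
      rw [LinearMap.comp_apply, hτ_of n σ hσ, hS_apply, map_sum]
      simp only [map_of, ← ContinuousMap.comp_assoc, hPh, hρ n σ hσ]
      simp [Nat.cast_smul_eq_nsmul]
  let Q : Chain X →ₗ[ℚ] Chain X := ∑ g, prism (K g)
  have hQ_apply : ∀ c, Q c = ∑ g, prism (K g) c := fun c => LinearMap.sum_apply _ _ _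
  have hQ : ∀ c, d (Q c) = S c - (Fintype.card G : ℚ) • c - Q (d c) := fun c => by
    rw [hQ_apply, hQ_apply, map_sum, hS_apply]
    have h0 : ∀ g, slice (K g) (vert 0) = ContinuousMap.id X := fun g => ContinuousMap.ext (hK0 g)
    have h1 : ∀ g, slice (K g) (vert 1) = h g := fun g => ContinuousMap.ext (hK1 g)
    simp only [d_prism, h0, h1, map_id, Finset.sum_sub_distrib]
    simp [Nat.cast_smul_eq_nsmul]
  have hQ_mem : ∀ c ∈ on (simpIn T), Q c ∈ on (simpIn T) := fun c hc => by
    rw [hQ_apply]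
    exact Submodule.sum_mem _ fun g _ => prism_mem_simpIn (hK g) hc
  have hN : (Fintype.card G : ℚ) ≠ 0 := by positivity
  generalize (Fintype.card G : ℚ) = N at hPτ hQ hN
  rintro ⟨z, w⟩ ⟨hz, hw⟩ ⟨hdz, hzw⟩
  simp only [coneD_apply] at hz hw hdz hzw
  replace hdz : d z = 0 := by simpa using hdz
  replace hzw : map P z = d w := by simpa [sub_eq_zero] using hzw
  let u := N⁻¹ • (τ w - Q z)
  have hu : u ∈ on (simpIn T) :=
    Submodule.smul_mem _ _ (Submodule.sub_mem _ (hτ_mem w hw) (hQ_mem z hz))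
  have hdu : d u = z := by
    simp only [u, map_smul, map_sub]
    rw [hQ, hdz, ← hτd w hw, ← hzw, hτP z hz, map_zero, sub_zero, sub_sub_cancel, smul_smul,
      inv_mul_cancel₀ hN, one_smul]
  let e := map P u - w
  have he : e ∈ on (simpIn T) := Submodule.sub_mem _ (map_mem_simpIn hP hu) hw
  have hde : d e = 0 := by
    simp only [e, map_sub]
    rw [← map_d, hdu, hzw, sub_self]
  refine ⟨(u - N⁻¹ • τ e, 0), ⟨Submodule.sub_mem _ hu (Submodule.smul_mem _ _ (hτ_mem e he)),
    Submodule.zero_mem _⟩, ?_, ?_⟩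
  · simp [coneD_apply, hdu, ← hτd e he, hde]
  · simp only [coneD_apply, map_sub, map_smul, hPτ e he, smul_smul, inv_mul_cancel₀ hN, one_smul]
    simp [e]

end

end SingularChains

namespace SingularChains

open Finsupp Chain Topology

section Roots
variable {n : ℕ}

/-- A nonvanishing function on a simplex has continuous roots. -/
lemma exists_continuous_root {W : ℕ} (hW : W ≠ 0) (f : C(Simplex n, ℂ)) (hf : ∀ t, f t ≠ 0) :
    ∃ g : C(Simplex n, ℂ), ∀ t, g t ^ W = f t := by
  cases n with
  | zero => exact ⟨f, fun t => by have := t.2.2; simp at this⟩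
  | succ n =>
    have cov := Complex.isCoveringMap_exp
    let c : Simplex (n + 1) → unitInterval → Simplex (n + 1) := fun t s =>
      ⟨(1 - (s : ℝ)) • (vert 0 : Simplex (n + 1)).1 + (s : ℝ) • t.1,
        convex_stdSimplex ℝ _ (vert 0 : Simplex (n + 1)).2 t.2 (by linarith [s.2.2]) s.2.1
          (by ring)⟩
    have hc : Continuous fun p : unitInterval × Simplex (n + 1) => c p.2 p.1 := by
      refine Continuous.subtype_mk ?_ _
      exact ((continuous_const.sub (continuous_subtype_val.comp continuous_fst)).smul
        continuous_const).add ((continuous_subtype_val.comp continuous_fst).smul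
        (continuous_subtype_val.comp continuous_snd))
    let H : C(unitInterval × Simplex (n + 1), {z : ℂ // z ≠ 0}) :=
      ⟨fun p => ⟨f (c p.2 p.1), hf _⟩, (f.continuous.comp hc).subtype_mk _⟩
    have H0 : ∀ a, H (0, a) = ⟨Complex.exp (ContinuousMap.const _
        (Complex.log (f (vert 0))) a), Complex.exp_ne_zero _⟩ := fun a => by
      apply Subtype.ext
      simp [H, c, Complex.exp_log (hf _)]
    let L := cov.liftHomotopy H (ContinuousMap.const _ (Complex.log (f (vert 0)))) H0
    refine ⟨⟨fun t => Complex.exp (L (1, t) / W), by fun_prop⟩, fun t => ?_⟩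
    have h := congrArg Subtype.val (congrFun (cov.liftHomotopy_lifts H _ H0) (1, t))
    have h1 : Complex.exp (L (1, t)) = f t := by
      refine h.trans ?_
      simp [H, c]
    show Complex.exp (L (1, t) / W) ^ W = f t
    rw [← Complex.exp_nat_mul, mul_div_cancel₀ _ (Nat.cast_ne_zero.2 hW), h1]

lemma exists_rootOfUnity {W : ℕ} [NeZero W] (f g : C(Simplex n, ℂ)) (hf : ∀ t, f t ≠ 0)
    (h : ∀ t, f t ^ W = g t ^ W) :
    ∃ ζ : rootsOfUnity W ℂ, ∀ t, g t = ((ζ : ℂˣ) : ℂ) * f t := by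
  cases n with
  | zero => exact ⟨1, fun t => by have := t.2.2; simp at this⟩
  | succ n =>
    have hq : ∀ t, (g t / f t) ^ W = 1 := fun t => by
      rw [div_pow, ← h, div_self (pow_ne_zero _ (hf t))]
    have hfin : {z : ℂ | z ^ W = 1}.Finite := by
      refine (Polynomial.nthRoots W (1 : ℂ)).toFinset.finite_toSet.subset fun z hz => ?_
      have hz : z ^ W = 1 := hz
      simpa [Polynomial.mem_nthRoots (NeZero.pos W)] using hz
    have hconn : PreconnectedSpace (Simplex (n + 1)) :=
      Subtype.preconnectedSpace (convex_stdSimplex ℝ (Fin (n + 1))).isPreconnected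
    have hconst : ∀ t, g t / f t = g (vert 0) / f (vert 0) := fun t =>
      isPreconnected_univ.constant_of_mapsTo (T := {z : ℂ | z ^ W = 1})
        (f := fun t => g t / f t) hfin.isDiscrete (g.continuous.div f.continuous hf).continuousOn
        (fun t _ => hq t) trivial trivial
    refine ⟨rootsOfUnity.mkOfPowEq _ (hq (vert 0)), fun t => ?_⟩
    rw [rootsOfUnity.val_mkOfPowEq_coe, ← hconst, div_mul_cancel₀ _ (hf t)]

end Roots

section
variable {κ ι : Type}

/-- The matrices of rank at most one. -/
def RankLEOne (m : κ → ι → ℂ) : Prop := ∀ j j' i i', m j i * m j' i' = m j i' * m j' i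

lemma RankLEOne.mul {m : κ → ι → ℂ} (hm : RankLEOne m) (a : κ → ℂ) (b : ι → ℂ) :
    RankLEOne fun j i => a j * b i * m j i := fun j j' i i' => by
  linear_combination a j * b i * a j' * b i' * hm j j' i i'

/-- The matrices of rank one with prescribed vanishing entries. -/
def torus (J : Set κ) (I : Set ι) : Set (κ → ι → ℂ) :=
  {m | RankLEOne m ∧ ∀ j i, m j i ≠ 0 ↔ j ∈ J ∧ i ∈ I}

/-- The entrywise power. -/
def powMap (κ ι : Type) (W : ℕ) : C(κ → ι → ℂ, κ → ι → ℂ) where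
  toFun m j i := m j i ^ W

lemma RankLEOne.powMap {m : κ → ι → ℂ} (hm : RankLEOne m) (W : ℕ) :
    RankLEOne (powMap κ ι W m) := fun j j' i i' => by
  simp only [SingularChains.powMap, ContinuousMap.coe_mk, ← mul_pow, hm j j' i i']

lemma mul_mem_torus {J : Set κ} {I : Set ι} {m : κ → ι → ℂ} (hm : m ∈ torus J I) (a : κ → ℂ)
    (b : ι → ℂ) (ha : ∀ j, a j ≠ 0) (hb : ∀ i, b i ≠ 0) :
    (fun j i => a j * b i * m j i) ∈ torus J I := by
  refine ⟨RankLEOne.mul hm.1 a b, fun j i => ?_⟩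
  rw [← hm.2 j i]
  simp [ha, hb]

lemma powMap_mem_torus {W : ℕ} [NeZero W] {J : Set κ} {I : Set ι} :
    Set.MapsTo (powMap κ ι W) (torus J I) (torus J I) := fun m hm =>
  ⟨hm.1.powMap W, fun j i => by rw [← hm.2 j i]; exact pow_ne_zero_iff (NeZero.ne W)⟩

lemma pairIso_torus [Fintype κ] [Fintype ι] (W : ℕ) [NeZero W] {J : Set κ} {I : Set ι}
    (hJ : J.Nonempty) (hI : I.Nonempty) : PairIso (powMap κ ι W) ∅ (simpIn (torus J I)) := by
  classical
  have := Fintype.ofFinite (rootsOfUnity W ℂ)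
  obtain ⟨j₀, hj₀⟩ := hJ
  obtain ⟨i₀, hi₀⟩ := hI
  let scale : ((κ → rootsOfUnity W ℂ) × (ι → rootsOfUnity W ℂ)) → C(κ → ι → ℂ, κ → ι → ℂ) :=
    fun g => ⟨fun m j i => ((g.1 j : ℂˣ) : ℂ) * ((g.2 i : ℂˣ) : ℂ) * m j i, by fun_prop⟩
  have hroot : ∀ ζ : rootsOfUnity W ℂ, ((ζ : ℂˣ) : ℂ) ^ W = 1 := fun ζ => by
    have := (mem_rootsOfUnity W _).1 ζ.2
    rw [← Units.val_pow_eq_pow_val, this, Units.val_one]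
  refine PairIso.of_transfer powMap_mem_torus scale
    (fun g m hm => mul_mem_torus hm _ _ (fun _ => Units.ne_zero _) fun _ => Units.ne_zero _)
    ?_ ?_ ?_ ?_
    (fun g => ⟨fun p j i => Complex.exp ((p.2.1 1 : ℝ) * Complex.log ((g.1 j : ℂˣ) : ℂ)) *
      Complex.exp ((p.2.1 1 : ℝ) * Complex.log ((g.2 i : ℂˣ) : ℂ)) * p.1 j i, ?_⟩)
    (fun g m hm e => mul_mem_torus hm _ _ (fun _ => Complex.exp_ne_zero _)
      fun _ => Complex.exp_ne_zero _) ?_ ?_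
  · intro g g'
    ext m j i
    simp only [scale, ContinuousMap.comp_apply, ContinuousMap.coe_mk, Prod.fst_mul, Prod.snd_mul,
      Pi.mul_apply, Subgroup.coe_mul, Units.val_mul]
    ring
  · intro g
    ext m j i
    simp [scale, powMap, mul_pow, hroot]
  · intro n σ hσ
    have hx : ∀ j, ∃ g : C(Simplex n, ℂ), j ∈ J → ∀ t, g t ^ W = σ t j i₀ := fun j => by
      by_cases hj : j ∈ J
      · obtain ⟨g, hg⟩ := exists_continuous_root (NeZero.ne W)
          (⟨fun t => σ t j i₀, by fun_prop⟩ : C(Simplex n, ℂ))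
          (fun t => ((hσ t).2 j i₀).2 ⟨hj, hi₀⟩)
        exact ⟨g, fun _ => hg⟩
      · exact ⟨0, fun h => (hj h).elim⟩
    have h00 : ∀ t, σ t j₀ i₀ ≠ 0 := fun t => ((hσ t).2 j₀ i₀).2 ⟨hj₀, hi₀⟩
    have hy : ∀ i, ∃ g : C(Simplex n, ℂ), i ∈ I → ∀ t, g t ^ W = σ t j₀ i / σ t j₀ i₀ := fun i => by
      by_cases hi : i ∈ I
      · obtain ⟨g, hg⟩ := exists_continuous_root (NeZero.ne W)
          (⟨fun t => σ t j₀ i / σ t j₀ i₀, Continuous.div (by fun_prop) (by fun_prop) h00⟩ :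
            C(Simplex n, ℂ))
          (fun t => div_ne_zero (((hσ t).2 j₀ i).2 ⟨hj₀, hi⟩) (h00 t))
        exact ⟨g, fun _ => hg⟩
      · exact ⟨0, fun h => (hi h).elim⟩
    choose x hx using hx
    choose y hy using hy
    let ρ : C(Simplex n, κ → ι → ℂ) :=
      ⟨fun t j i => if j ∈ J ∧ i ∈ I then x j t * y i t else 0, by
        refine continuous_pi fun j => continuous_pi fun i => ?_
        split_ifs
        · fun_prop
        · exact continuous_const⟩
    have hρ : ∀ t j i, ρ t j i = if j ∈ J ∧ i ∈ I then x j t * y i t else 0 := fun _ _ _ => rfl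
    have hρσ : ∀ t j i, ρ t j i ^ W = σ t j i := fun t j i => by
      rw [hρ]
      split_ifs with h
      · rw [mul_pow, hx j h.1, hy i h.2, mul_div_assoc', div_eq_iff (h00 t)]
        linear_combination -(hσ t).1 j j₀ i i₀
      · rw [zero_pow (NeZero.ne W)]
        by_contra h0
        exact h (((hσ t).2 j i).1 (Ne.symm h0))
    refine ⟨ρ, fun t => ⟨fun j j' i i' => ?_, fun j i => ?_⟩, ?_⟩
    · show ρ t j i * ρ t j' i' = ρ t j i' * ρ t j' i
      simp only [hρ]
      by_cases h1 : j ∈ J <;> by_cases h2 : j' ∈ J <;> by_cases h3 : i ∈ I <;>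
        by_cases h4 : i' ∈ I <;> simp [h1, h2, h3, h4]
      ring
    · rw [← (hσ t).2 j i, ← hρσ t j i]
      exact (pow_ne_zero_iff (NeZero.ne W)).symm
    · ext t j i
      exact hρσ t j i
  · intro n α β hα hβ hαβ
    have hW : ∀ t j i, α t j i ^ W = β t j i ^ W := fun t j i =>
      congrFun (congrFun (DFunLike.congr_fun hαβ t) j) i
    have key : ∀ j i, ∃ ζ : rootsOfUnity W ℂ, j ∈ J → i ∈ I →
        ∀ t, β t j i = ((ζ : ℂˣ) : ℂ) * α t j i := fun j i => by
      by_cases h : j ∈ J ∧ i ∈ I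
      · obtain ⟨ζ, hζ⟩ := exists_rootOfUnity (W := W)
          (⟨fun t => α t j i, by fun_prop⟩ : C(Simplex n, ℂ)) ⟨fun t => β t j i, by fun_prop⟩
          (fun t => ((hα t).2 j i).2 h) (fun t => hW t j i)
        exact ⟨ζ, fun _ _ => hζ⟩
      · exact ⟨1, fun h1 h2 => (h ⟨h1, h2⟩).elim⟩
    choose ζ hζ using key
    refine ⟨(fun j => ζ j i₀, fun i => ζ j₀ i * (ζ j₀ i₀)⁻¹), ?_⟩
    ext t j i
    show β t j i = ((ζ j i₀ : ℂˣ) : ℂ) * (((ζ j₀ i * (ζ j₀ i₀)⁻¹ : rootsOfUnity W ℂ) : ℂˣ) : ℂ) *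
      α t j i
    by_cases h : j ∈ J ∧ i ∈ I
    · have h1 := hζ j i₀ h.1 hi₀ t
      have h2 := hζ j₀ i hj₀ h.2 t
      have h3 := hζ j₀ i₀ hj₀ hi₀ t
      have h4 := (hα t).1 j j₀ i i₀
      have h5 := (hβ t).1 j j₀ i i₀
      have h6 := ((hα t).2 j₀ i₀).2 ⟨hj₀, hi₀⟩
      have h7 : ((ζ j₀ i₀ : ℂˣ) : ℂ) ≠ 0 := Units.ne_zero _
      rw [h1, h2, h3] at h5
      simp only [Subgroup.coe_mul, Subgroup.coe_inv, Units.val_mul, Units.val_inv_eq_inv_val]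
      apply mul_right_cancel₀ (mul_ne_zero h7 h6)
      rw [h5]
      field_simp
      linear_combination -h4
    · have h1 : α t j i = 0 := by
        by_contra h0
        exact h (((hα t).2 j i).1 h0)
      have h2 : β t j i = 0 := by
        by_contra h0
        exact h (((hβ t).2 j i).1 h0)
      rw [h1, h2, mul_zero]
  · refine continuous_pi fun j => continuous_pi fun i => ?_
    have : Continuous fun p : (κ → ι → ℂ) × Simplex 2 => p.2.1 1 :=
      (continuous_apply 1).comp (continuous_subtype_val.comp continuous_snd)
    fun_prop
  · intro g m
    ext j i
    simp [vert]
  · intro g m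
    ext j i
    simp [vert, scale, Complex.exp_log]

/-- The matrices of rank one with nonvanishing entries at given places. -/
def chart (σ : Set (κ × ι)) : Set (κ → ι → ℂ) :=
  {m | m ≠ 0 ∧ RankLEOne m ∧ ∀ p ∈ σ, m p.1 p.2 ≠ 0}

lemma powMap_mem_chart {W : ℕ} [NeZero W] {σ : Set (κ × ι)} :
    Set.MapsTo (powMap κ ι W) (chart σ) (chart σ) := fun m hm => by
  refine ⟨fun h => hm.1 ?_, hm.2.1.powMap W, fun p hp => pow_ne_zero W (hm.2.2 p hp)⟩
  ext j i
  exact eq_zero_of_pow_eq_zero (congrFun (congrFun h j) i)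

lemma pairIso_chart_of_nonempty [Fintype κ] [Fintype ι] (W : ℕ) [NeZero W] {σ : Set (κ × ι)}
    (hσ : σ.Nonempty) : PairIso (powMap κ ι W) ∅ (simpIn (chart σ)) := by
  classical
  let J := Prod.fst '' σ
  let I := Prod.snd '' σ
  have hne : ∀ m ∈ chart σ, ∀ j ∈ J, ∀ i ∈ I, m j i ≠ 0 := by
    rintro m hm j ⟨p, hp, rfl⟩ i ⟨q, hq, rfl⟩ h
    have := hm.2.1 p.1 q.1 q.2 p.2
    rw [h, zero_mul] at this
    exact mul_ne_zero (hm.2.2 p hp) (hm.2.2 q hq) this.symm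
  obtain ⟨p₀, hp₀⟩ := hσ
  have hsub : torus J I ⊆ chart σ := fun m hm => by
    have h : ∀ p ∈ σ, m p.1 p.2 ≠ 0 := fun p hp =>
      (hm.2 _ _).2 ⟨Set.mem_image_of_mem _ hp, Set.mem_image_of_mem _ hp⟩
    exact ⟨fun h0 => h p₀ hp₀ (by rw [h0]; rfl), hm.1, h⟩
  let a : ℝ → κ → ℂ := fun s j => if j ∈ J then 1 else 1 - s
  let b : ℝ → ι → ℂ := fun s i => if i ∈ I then 1 else 1 - s
  refine RelAcyclic.trans (coneD_coneD _) (coneOn_mono (Set.empty_subset _))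
    (coneOn_mono (simpIn_mono hsub)) (pairIso_torus W (J := J) (I := I)
      ⟨_, Set.mem_image_of_mem _ hp₀⟩ ⟨_, Set.mem_image_of_mem _ hp₀⟩)
    (PairIso.of_acyc (Acyc.of_real_deformation (fun s m j i => a s j * b s i * m j i)
      ?_ ?_ ?_ ?_ ?_) (fun c hc => map_mem_simpIn powMap_mem_torus hc)
      fun c hc => map_mem_simpIn powMap_mem_chart hc)
  · refine continuous_pi fun j => continuous_pi fun i => ?_
    simp only [a, b]
    split_ifs <;> fun_prop
  · intro m
    ext j i
    simp [a, b]
  · intro s _ m hm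
    have h : ∀ p ∈ σ, a s p.1 * b s p.2 * m p.1 p.2 ≠ 0 := fun p hp => by
      simp only [a, b]
      rw [if_pos (Set.mem_image_of_mem _ hp), if_pos (Set.mem_image_of_mem _ hp)]
      simpa using hm.2.2 p hp
    exact ⟨fun h0 => h p₀ hp₀ (congrFun (congrFun h0 _) _), hm.2.1.mul _ _, h⟩
  · intro s _ m hm
    refine ⟨hm.1.mul _ _, fun j i => ?_⟩
    rw [← hm.2 j i]
    constructor
    · exact fun h h0 => h (by simp [h0])
    · intro h
      have := (hm.2 j i).1 h
      simpa [a, b, if_pos this.1, if_pos this.2] using h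
  · intro m hm
    refine ⟨hm.2.1.mul _ _, fun j i => ?_⟩
    by_cases hj : j ∈ J <;> by_cases hi : i ∈ I <;> simp [a, b, hj, hi]
    exact hne m hm j hj i hi

lemma pairIso_chart [Fintype κ] [Fintype ι] (W : ℕ) [NeZero W] (s : Finset (κ × ι))
    (σ : Set (κ × ι)) :
    PairIso (powMap κ ι W) ∅ (simpIn (chart σ ∩ {m | ∃ p ∈ s, m p.1 p.2 ≠ 0})) := by
  classical
  have hpow : ∀ (σ : Set (κ × ι)) (s : Finset (κ × ι)), Set.MapsTo (powMap κ ι W)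
      (chart σ ∩ {m | ∃ p ∈ s, m p.1 p.2 ≠ 0}) (chart σ ∩ {m | ∃ p ∈ s, m p.1 p.2 ≠ 0}) := by
    rintro σ s m ⟨hm, p, hp, h⟩
    exact ⟨powMap_mem_chart hm, p, hp, pow_ne_zero W h⟩
  induction s using Finset.induction_on generalizing σ with
  | empty =>
    have : chart σ ∩ {m | ∃ p ∈ (∅ : Finset (κ × ι)), m p.1 p.2 ≠ 0} = ∅ := by
      ext m; simp
    rw [this]
    exact PairIso.empty _
  | insert p s hp ih =>
    have hO₁ : IsOpen {m : κ → ι → ℂ | m p.1 p.2 ≠ 0} :=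
      isOpen_ne_fun (by fun_prop) continuous_const
    have hO₂ : IsOpen {m : κ → ι → ℂ | ∃ q ∈ s, m q.1 q.2 ≠ 0} := by
      have : {m : κ → ι → ℂ | ∃ q ∈ s, m q.1 q.2 ≠ 0} = ⋃ q ∈ s, {m | m q.1 q.2 ≠ 0} := by
        ext m; simp
      rw [this]
      exact isOpen_biUnion fun q _ => isOpen_ne_fun (by fun_prop) continuous_const
    have e₁ : chart σ ∩ {m | ∃ q ∈ insert p s, m q.1 q.2 ≠ 0} ∩ {m | m p.1 p.2 ≠ 0} =
        chart (insert p σ) := by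
      ext m
      simp [chart]
      tauto
    have e₂ : chart σ ∩ {m | ∃ q ∈ insert p s, m q.1 q.2 ≠ 0} ∩
        {m | ∃ q ∈ s, m q.1 q.2 ≠ 0} = chart σ ∩ {m | ∃ q ∈ s, m q.1 q.2 ≠ 0} := by
      ext m
      simp only [Finset.exists_mem_insert, Set.mem_inter_iff, Set.mem_ofPred_eq]
      tauto
    have e₁₂ : chart (insert p σ) ∩ (chart σ ∩ {m | ∃ q ∈ s, m q.1 q.2 ≠ 0}) =
        chart (insert p σ) ∩ {m | ∃ q ∈ s, m q.1 q.2 ≠ 0} := by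
      ext m
      simp only [chart, Set.mem_inter_iff, Set.mem_ofPred_eq, Set.forall_mem_insert]
      tauto
    refine PairIso.union hO₁ hO₂ ?_ ?_ ?_ ?_ ?_ ?_
    · rintro m ⟨_, hm⟩
      exact (Finset.exists_mem_insert _ _ _).1 hm
    · rw [e₁]; exact powMap_mem_chart
    · rw [e₂]; exact hpow _ _
    · rw [e₁]; exact pairIso_chart_of_nonempty W (Set.insert_nonempty _ _)
    · rw [e₂]; exact ih σ
    · rw [e₁, e₂, e₁₂]; exact ih _

lemma pairIso_rankLEOne [Fintype κ] [Fintype ι] (W : ℕ) [NeZero W] :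
    PairIso (powMap κ ι W) ∅ (simpIn {m | m ≠ 0 ∧ RankLEOne m}) := by
  have := pairIso_chart W (Finset.univ : Finset (κ × ι)) ∅
  have e : chart (∅ : Set (κ × ι)) ∩ {m | ∃ p ∈ (Finset.univ : Finset (κ × ι)), m p.1 p.2 ≠ 0} =
      {m | m ≠ 0 ∧ RankLEOne m} := by
    ext m
    simp only [chart, Set.mem_inter_iff, Set.mem_ofPred_eq, Set.mem_empty_iff_false, false_imp_iff,
      implies_true, and_true, Finset.mem_univ, true_and]
    refine ⟨fun h => h.1, fun h => ⟨h, ?_⟩⟩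
    by_contra! h0
    exact h.1 (funext fun j => funext fun i => h0 (j, i))
  rwa [e] at this

end

end SingularChains

namespace SingularChains

open Finsupp Chain

section
variable {V X : Type} [TopologicalSpace V] [TopologicalSpace X]

/-- A self-map of `R` which is an isomorphism on homology detects the homology of every space
through which it factors. -/
lemma Acyc.of_factor {R : Set V} {P : C(V, V)} (hP : PairIso P ∅ (simpIn R)) (f : C(R, X))
    (g : C(X, V)) (hg : ∀ x, g x ∈ R) (hgf : ∀ r : R, g (f r) = P r) {n : ℤ}
    (h : Acyc n (simpIn ∅) (simpIn (Set.univ : Set X))) :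
    Acyc n (simpIn ∅) (simpIn R) := by
  have H := RelAcyclic.of_trans_right (coneD_coneD P) (coneOn_mono (Set.empty_subset _))
    (coneOn_mono (simpIn_mono (Set.empty_subset R))) (PairIso.empty P) hP
  intro c hc hdc
  obtain ⟨hcR, hcn⟩ := mem_on_inter.1 hc
  let incl : C(R, V) := ⟨Subtype.val, continuous_subtype_val⟩
  have hi : Topology.IsEmbedding incl := Topology.IsEmbedding.subtypeVal
  have hr : R ⊆ Set.range incl := fun r hr => ⟨⟨r, hr⟩, rfl⟩
  have hR : simpIn R ∩ deg V n = simpMap incl '' (simpIn Set.univ ∩ deg R n) := by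
    have e := simpMap_image_simpIn hi hr
    rw [← e, show (incl ⁻¹' R) = Set.univ from Set.eq_univ_of_forall fun r => r.2]
    ext p
    constructor
    · rintro ⟨⟨q, hq, rfl⟩, hn⟩
      exact ⟨q, ⟨hq, hn⟩, rfl⟩
    · rintro ⟨q, ⟨hq, hn⟩, rfl⟩
      exact ⟨⟨q, hq, rfl⟩, hn⟩
  rw [hR] at hc
  obtain ⟨c', hc', rfl⟩ := exists_of_mem_image hc
  have hdc' : d c' ∈ on (simpIn ∅) := by
    rw [← map_d, ← simpMap_image_simpIn hi (Set.empty_subset _), map_mem_image_iff hi.injective]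
      at hdc
    exact hdc
  obtain ⟨w, hw, hcw⟩ := h (map f c') (mem_on_inter.2 ⟨map_mem_simpIn (Set.mapsTo_univ _ _)
      (mem_on_inter.1 hc').1, map_mem_deg f (mem_on_inter.1 hc').2⟩) (by
    rw [← map_d]
    exact map_mem_simpIn (fun _ h => h.elim) hdc')
  have hgw : map g w ∈ on (simpIn R) :=
    map_mem_simpIn (S := Set.univ) (fun x _ => hg x) (mem_on_inter.1 hw).1
  have hgf' : map g (map f c') = map P (map incl c') := by
    rw [map_map, map_map]
    congr 2
    exact ContinuousMap.ext hgf
  obtain ⟨⟨u, v⟩, ⟨hu, -⟩, hcu, -⟩ := H (map incl c', map g w) ⟨hcR, hgw⟩ ⟨hdc, by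
      have := map_mem_simpIn (f := g) (S := ∅) (T := ∅) (fun _ h => h.elim) hcw
      rw [map_sub, hgf', map_d] at this
      exact this⟩
  refine ⟨component (n + 1) u, component_mem_on _ hu, ?_⟩
  rw [d_component, ← component_of_mem_deg hcn, ← map_sub]
  exact (mem_on_inter.1 (component_mem_on _ hcu)).1

end

end SingularChains

namespace SingularChains

section
variable {κ : Type} [Fintype κ]

lemma not_acyc_rankLEOne [Nonempty κ] {n : ℤ}
    (hn : n % 2 = 1 ∧ 1 ≤ n ∧ n ≤ 2 * Fintype.card κ - 1 ∨
      n % 2 = 0 ∧ 2 * Fintype.card κ ≤ n ∧ n ≤ 4 * Fintype.card κ - 2) :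
    ¬ Acyc n (simpIn ∅) (simpIn {m : κ → κ → ℂ | m ≠ 0 ∧ RankLEOne m}) := by
  have e := (Fintype.equivFin κ).symm
  let E : (κ → κ → ℂ) ≃ₜ (Fin (Fintype.card κ) → Fin (Fintype.card κ) → ℂ) :=
    { toFun := fun m i j => m (e i) (e j)
      invFun := fun m i j => m (e.symm i) (e.symm j)
      left_inv := fun m => by simp
      right_inv := fun m => by simp
      continuous_toFun := by fun_prop
      continuous_invFun := by fun_prop }
  have hE : E ⁻¹' rankOne (Fintype.card κ) (Fintype.card κ) = {m | m ≠ 0 ∧ RankLEOne m} := by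
    ext m
    have h0 : E m ≠ 0 ↔ m ≠ 0 := by
      refine not_congr ⟨fun h => E.injective (h.trans ?_), fun h => ?_⟩
      · rfl
      · subst h; rfl
    refine and_congr h0 ⟨fun h i i' j j' => ?_, fun h i i' j j' => h _ _ _ _⟩
    have := h (e.symm i) (e.symm i') (e.symm j) (e.symm j')
    simpa [E] using this
  rw [← hE, ← Set.preimage_empty (f := E), Acyc.homeomorph_iff,
    Acyc.rankOne_iff Fintype.card_pos le_rfl, not_not]
  omega

end

section
variable (N : ℕ) (d : Fin N → ℕ)

/-- The representation `⨁ ℂ^{d n}`. -/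
abbrev Rep : Type := ∀ n : Fin N, Fin (d n) → ℂ

/-- The pairs of nonzero vectors. -/
abbrev PuncturedPair : Type := {p : Rep N d × Rep N d // p.1 ≠ 0 ∧ p.2 ≠ 0}

/-- The relation of lying in the same orbit of `ℂ*`. -/
abbrev orbitSetoid : Setoid (PuncturedPair N d) :=
  Setoid.comap (Subtype.val : PuncturedPair N d → Rep N d × Rep N d)
    (actionSetoid (diagWeightHom N d))

/-- The indices of the coordinates. -/
abbrev Coord : Type := Σ n : Fin N, Fin (d n)

/-- The nonzero matrices of rank one indexed by the coordinates. -/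
abbrev RankOneMatrix : Type :=
  {m : Coord N d → Coord N d → ℂ | m ≠ 0 ∧ RankLEOne m}

/-- The vectors with outer product a given matrix, raised coordinatewise to the weights. -/
noncomputable def splitAt (a b : Coord N d) (m : Coord N d → Coord N d → ℂ) :
    Rep N d × Rep N d :=
  (fun n i => m ⟨n, i⟩ b ^ ((n : ℕ) + 1), fun n i => (m a ⟨n, i⟩ / m a b) ^ ((n : ℕ) + 1))

variable {N d}

lemma splitAt_ne_zero {a b : Coord N d} {m : Coord N d → Coord N d → ℂ} (h : m a b ≠ 0) :
    (splitAt N d a b m).1 ≠ 0 ∧ (splitAt N d a b m).2 ≠ 0 := by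
  constructor <;> intro h0
  · have := congrFun (congrFun h0 a.1) a.2
    simp [splitAt] at this
    exact h this
  · have := congrFun (congrFun h0 b.1) b.2
    simp [splitAt, h] at this

lemma diagWeightHom_apply (t : ℂˣ) (p : Rep N d × Rep N d) :
    diagWeightHom N d t p = (fun (n : Fin N) i => ((t : ℂ) ^ ((n : ℕ) + 1))⁻¹ * p.1 n i,
      fun (n : Fin N) i => (t : ℂ) ^ ((n : ℕ) + 1) * p.2 n i) := by
  refine Prod.ext ?_ ?_ <;> funext n i
  · change ((t ^ (-((n : ℕ) + 1) : ℤ) : ℂˣ) : ℂ) * p.1 n i = _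
    rw [zpow_neg]
    norm_cast
  · change ((t ^ (((n : ℕ) + 1 : ℕ) : ℤ) : ℂˣ) : ℂ) * p.2 n i = _
    norm_cast

lemma splitAt_rel {a b a' b' : Coord N d} {m : Coord N d → Coord N d → ℂ} (hm : RankLEOne m)
    (h : m a b ≠ 0) (h' : m a' b' ≠ 0) :
    ∃ t : ℂˣ, diagWeightHom N d t (splitAt N d a b m) = splitAt N d a' b' m := by
  have hab : m a b' ≠ 0 := fun h0 => by
    have := hm a a' b b'
    rw [h0, zero_mul] at this
    exact mul_ne_zero h h' this
  refine ⟨Units.mk0 (m a b / m a b') (div_ne_zero h hab), ?_⟩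
  rw [diagWeightHom_apply]
  refine Prod.ext ?_ ?_ <;> funext n i
  · simp only [splitAt, Units.val_mk0]
    rw [← inv_pow, ← mul_pow]
    congr 1
    field_simp
    linear_combination hm a ⟨n, i⟩ b' b
  · simp only [splitAt, Units.val_mk0]
    rw [← mul_pow]
    congr 1
    field_simp
    linear_combination hm a a' ⟨n, i⟩ b'

lemma RankOneMatrix.exists_ne (m : RankOneMatrix N d) : ∃ p : Coord N d × Coord N d,
    m.1 p.1 p.2 ≠ 0 := by
  by_contra! h
  exact m.2.1 (funext fun i => funext fun j => h (i, j))

/-- The decomposition of a matrix of rank one as an outer product, raised to the weights. -/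
noncomputable def split (m : RankOneMatrix N d) : Quotient (orbitSetoid N d) :=
  Quotient.mk _ ⟨splitAt N d _ _ m, splitAt_ne_zero (RankOneMatrix.exists_ne m).choose_spec⟩

lemma split_eq {a b : Coord N d} (m : RankOneMatrix N d) (h : m.1 a b ≠ 0) :
    split m = Quotient.mk (orbitSetoid N d) ⟨splitAt N d a b m, splitAt_ne_zero h⟩ :=
  Quotient.sound (s := orbitSetoid N d)
    (splitAt_rel m.2.2 (RankOneMatrix.exists_ne m).choose_spec h)

lemma continuous_split : Continuous (split : RankOneMatrix N d → _) := by
  rw [continuous_iff_continuousAt]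
  intro m
  obtain ⟨⟨a, b⟩, h⟩ := RankOneMatrix.exists_ne m
  have hO : IsOpen {m : RankOneMatrix N d | m.1 a b ≠ 0} :=
    isOpen_ne_fun ((continuous_apply_apply a b).comp continuous_subtype_val) continuous_const
  refine ContinuousOn.continuousAt (s := {m : RankOneMatrix N d | m.1 a b ≠ 0}) ?_
    (hO.mem_nhds h)
  rw [continuousOn_iff_continuous_domRestrict]
  have e : Set.domRestrict {m : RankOneMatrix N d | m.1 a b ≠ 0} split =
      fun m : {m : RankOneMatrix N d | m.1 a b ≠ 0} => Quotient.mk (orbitSetoid N d)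
        ⟨splitAt N d a b m.1, splitAt_ne_zero (show m.1.1 a b ≠ 0 from m.2)⟩ :=
    funext fun m => split_eq m.1 m.2
  rw [e]
  refine continuous_quot_mk.comp (Continuous.subtype_mk ?_ _)
  have hc (x y : Coord N d) :
      Continuous fun m : {m : RankOneMatrix N d | m.1 a b ≠ 0} => m.1.1 x y :=
    (continuous_apply_apply x y).comp (continuous_subtype_val.comp continuous_subtype_val)
  exact (continuous_pi fun n => continuous_pi fun i => (hc _ _).pow _).prodMk
    (continuous_pi fun n => continuous_pi fun i => ((hc _ _).div (hc _ _) fun m => m.2).pow _)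

/-- The outer product of the coordinatewise powers with exponents `W / n`. -/
def outer (W : ℕ) (p : Rep N d × Rep N d) : Coord N d → Coord N d → ℂ := fun a b =>
  p.1 a.1 a.2 ^ (W / ((a.1 : ℕ) + 1)) * p.2 b.1 b.2 ^ (W / ((b.1 : ℕ) + 1))

lemma outer_diagWeightHom {W : ℕ} (hW : ∀ n : Fin N, (n : ℕ) + 1 ∣ W) (t : ℂˣ)
    (p : Rep N d × Rep N d) : outer W (diagWeightHom N d t p) = outer W p := by
  funext a b
  simp only [diagWeightHom_apply, outer, mul_pow, inv_pow, ← pow_mul, Nat.mul_div_cancel' (hW _)]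
  field_simp

lemma outer_mem {W : ℕ} {p : Rep N d × Rep N d} (hp : p.1 ≠ 0 ∧ p.2 ≠ 0) :
    outer W p ∈ {m : Coord N d → Coord N d → ℂ | m ≠ 0 ∧ RankLEOne m} := by
  refine ⟨fun h => ?_, fun a a' b b' => by simp only [outer]; ring⟩
  obtain ⟨n, hn⟩ := Function.ne_iff.1 hp.1
  obtain ⟨i, hi⟩ := Function.ne_iff.1 hn
  obtain ⟨n', hn'⟩ := Function.ne_iff.1 hp.2
  obtain ⟨i', hi'⟩ := Function.ne_iff.1 hn'
  exact mul_ne_zero (pow_ne_zero _ hi) (pow_ne_zero _ hi')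
    (congrFun (congrFun h ⟨n, i⟩) ⟨n', i'⟩)

lemma outer_splitAt {W : ℕ} (hW : ∀ n : Fin N, (n : ℕ) + 1 ∣ W) {a b : Coord N d}
    {m : Coord N d → Coord N d → ℂ} (hm : RankLEOne m) (h : m a b ≠ 0) :
    outer W (splitAt N d a b m) = powMap _ _ W m := by
  funext x y
  simp only [outer, splitAt, ← pow_mul, Nat.mul_div_cancel' (hW _), powMap, ContinuousMap.coe_mk]
  rw [← mul_pow]
  congr 1
  field_simp
  linear_combination hm x a b y

lemma finrank_rep : Module.finrank ℂ (Rep N d) = Fintype.card (Coord N d) := by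
  simp [Module.finrank_pi_fintype]

/-- The homology of the orbit space of the pairs of nonzero vectors. -/
lemma not_acyc_orbitSpace (hd : ∃ n, d n ≠ 0) {n : ℤ}
    (hn : n % 2 = 1 ∧ 1 ≤ n ∧ n ≤ 2 * Module.finrank ℂ (Rep N d) - 1 ∨
      n % 2 = 0 ∧ 2 * Module.finrank ℂ (Rep N d) ≤ n ∧ n ≤ 4 * Module.finrank ℂ (Rep N d) - 2) :
    ¬ Acyc n (simpIn ∅) (simpIn (Set.univ : Set (Quotient (orbitSetoid N d)))) := by
  rw [finrank_rep] at hn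
  have : Nonempty (Coord N d) := by
    obtain ⟨n, h⟩ := hd
    exact ⟨⟨n, ⟨0, Nat.pos_of_ne_zero h⟩⟩⟩
  refine fun h => not_acyc_rankLEOne hn ?_
  have hW : ∀ n : Fin N, (n : ℕ) + 1 ∣ N.factorial := fun n =>
    Nat.dvd_factorial n.1.succ_pos n.2
  have : NeZero N.factorial := ⟨N.factorial_ne_zero⟩
  let g : C(Quotient (orbitSetoid N d), Coord N d → Coord N d → ℂ) :=
    { toFun := Quotient.lift (fun p : PuncturedPair N d => outer N.factorial p.1) (by
        rintro p q ⟨t, ht⟩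
        change diagWeightHom N d t p.1 = q.1 at ht
        rw [← ht, outer_diagWeightHom hW])
      continuous_toFun := Continuous.quotient_lift (by unfold outer; fun_prop) _ }
  refine Acyc.of_factor (pairIso_rankLEOne N.factorial) ⟨split, continuous_split⟩ g ?_ ?_ h
  · rintro ⟨p⟩
    exact outer_mem p.2
  · intro m
    exact outer_splitAt hW m.2.2 (RankOneMatrix.exists_ne m).choose_spec

end

end SingularChains

namespace SingularChains

section
variable {V : Type} [NormedAddCommGroup V] [NormedSpace ℝ V] [FiniteDimensional ℝ V]

lemma Acyc.sphere {n : ℤ} (h1 : n ≠ 1) (h2 : n ≠ Module.finrank ℝ V) :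
    Acyc n (simpIn ∅) (simpIn (Set.univ : Set (Metric.sphere (0 : V) 1))) := by
  let i : C({v : V | v ≠ 0}, V) := ⟨Subtype.val, continuous_subtype_val⟩
  have hi : Topology.IsEmbedding i := Topology.IsEmbedding.subtypeVal
  have hV : Acyc n (simpIn ∅) (simpIn (Set.univ : Set {v : V | v ≠ 0})) := by
    have := (embedding_iff hi (Set.empty_subset _) fun v hv => ⟨⟨v, hv⟩, rfl⟩).2
      (Acyc.punctured h1 h2)
    rwa [Set.preimage_empty, show i ⁻¹' {v | v ≠ 0} = Set.univ from
      Set.eq_univ_of_forall fun v => v.2] at this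
  have hne (v : {v : V | v ≠ 0}) : ‖v.1‖ ≠ 0 := norm_ne_zero_iff.2 v.2
  have hT (m : ℤ) : Acyc m (simpIn {v : {v : V | v ≠ 0} | ‖v.1‖ = 1}) (simpIn Set.univ) := by
    refine Acyc.of_real_deformation
      (fun s v => ⟨‖v.1‖ ^ (-s) • v.1, smul_ne_zero
        (Real.rpow_pos_of_pos (norm_pos_iff.2 v.2) _).ne' v.2⟩) ?_ ?_ ?_ ?_ ?_ m
    · refine Continuous.subtype_mk (Continuous.smul ?_ (by fun_prop)) _
      exact Continuous.rpow (by fun_prop) (by fun_prop) fun p => Or.inl (hne p.1)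
    · intro v
      simp
    · exact fun s _ v _ => trivial
    · intro s _ v hv
      have hv' : ‖v.1‖ = 1 := hv
      change ‖‖v.1‖ ^ (-s) • v.1‖ = 1
      rw [hv', Real.one_rpow, one_smul, hv']
    · intro v _
      change ‖‖v.1‖ ^ (-1 : ℝ) • v.1‖ = 1
      rw [Real.rpow_neg_one, norm_smul, norm_inv, norm_norm, inv_mul_cancel₀ (hne v)]
  have := (Acyc.left_iff (simpIn_mono (Set.empty_subset _)) (simpIn_mono (Set.subset_univ _)) hT).2
    hV
  let f : C(Metric.sphere (0 : V) 1, {v : V | v ≠ 0}) :=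
    ⟨fun v => ⟨v.1, ne_zero_of_mem_unit_sphere v⟩, by fun_prop⟩
  have hf : Topology.IsEmbedding f :=
    Topology.IsEmbedding.of_comp f.continuous hi.continuous Topology.IsEmbedding.subtypeVal
  have h := (embedding_iff hf (Set.empty_subset _) fun v hv =>
    ⟨⟨v.1, by simpa using hv⟩, rfl⟩).2 this
  rwa [Set.preimage_empty, show f ⁻¹' {v | ‖v.1‖ = 1} = Set.univ from
    Set.eq_univ_of_forall fun v => by simp [f]] at h

end

lemma Acyc.of_isEmpty {X : Type} [TopologicalSpace X] [IsEmpty X] {n : ℤ} :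
    Acyc n (simpIn ∅) (simpIn (Set.univ : Set X)) := by
  rw [show (Set.univ : Set X) = ∅ from Set.univ_eq_empty_iff.2 ‹_›]
  exact Acyc.refl _ _

lemma sphereSpace_eq {m : ℤ} (hm : 0 ≤ m) :
    SphereSpace m = Metric.sphere (0 : EuclideanSpace ℝ (Fin (m.toNat + 1))) 1 := if_pos hm

lemma topologicalSpace_sphereSpace_heq {m : ℤ} (hm : 0 ≤ m) :
    (inferInstance : TopologicalSpace (SphereSpace m)) ≍
      (inferInstance : TopologicalSpace
        (Metric.sphere (0 : EuclideanSpace ℝ (Fin (m.toNat + 1))) 1)) := by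
  have key {p : Prop} {A : Type} (x : Decidable p) (hp : p) (f : p → A) (g : ¬ p → A) :
      Decidable.casesOn (motive := fun _ => A) x g f = f hp := by
    cases x
    · contradiction
    · rfl
  exact (heq_of_eq (key _ hm _ _)).trans (cast_heq _ _)

lemma exists_homeomorph_of_heq {X Y : Type} [t : TopologicalSpace X] [t' : TopologicalSpace Y]
    (h : X = Y) (ht : t ≍ t') : Nonempty (X ≃ₜ Y) := by
  subst h
  obtain rfl := eq_of_heq ht
  exact ⟨Homeomorph.refl X⟩

lemma Acyc.sphereSpace {m n : ℤ} (h1 : n ≠ 1) (h2 : n ≠ m + 1) :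
    Acyc n (simpIn ∅) (simpIn (Set.univ : Set (SphereSpace m))) := by
  by_cases hm : 0 ≤ m
  · have := Acyc.sphere (V := EuclideanSpace ℝ (Fin (m.toNat + 1))) h1 (by simp; omega)
    obtain ⟨e⟩ := exists_homeomorph_of_heq (sphereSpace_eq hm)
      (topologicalSpace_sphereSpace_heq hm)
    have h := (Acyc.homeomorph_iff e).2 this
    simpa using h
  · have : IsEmpty (SphereSpace m) := by
      rw [SphereSpace, if_neg hm]
      infer_instance
    exact Acyc.of_isEmpty

end SingularChains

namespace SingularChains

open Chain Simplicial

section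
variable (X : Type) [TopologicalSpace X]

/-- The complex of singular chains in the category of modules. -/
noncomputable abbrev singularComplex : ChainComplex (ModuleCat ℚ) ℕ :=
  (AlgebraicTopology.alternatingFaceMapComplex (ModuleCat ℚ)).obj
    (((SimplicialObject.whiskering _ _).obj (ModuleCat.free ℚ)).obj
      (TopCat.toSSet.obj (TopCat.of X)))

variable {X}

/-- The singular simplex given by a simplex of the singular simplicial set. -/
noncomputable def toSingularSimplex (n : ℕ) (s : TopCat.toSSet.obj (TopCat.of X) _⦋n⦌) :
    C(Simplex (n + 1), X) := TopCat.toSSetObjEquiv (TopCat.of X) _ s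

/-- The comparison of the two definitions of singular chains. -/
noncomputable def toChain (n : ℕ) : (singularComplex X).X n →ₗ[ℚ] Chain X :=
  Finsupp.lmapDomain ℚ ℚ fun s => ⟨n + 1, toSingularSimplex n s⟩

lemma toChain_freeMk (n : ℕ) (s : TopCat.toSSet.obj (TopCat.of X) _⦋n⦌) :
    toChain n (ModuleCat.freeMk s) = of (toSingularSimplex n s) :=
  Finsupp.mapDomain_single

lemma toChain_injective (n : ℕ) : Function.Injective (toChain (X := X) n) := by
  refine Finsupp.mapDomain_injective fun s t h => ?_
  obtain ⟨-, h⟩ := Sigma.mk.inj_iff.1 h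
  exact (TopCat.toSSetObjEquiv (TopCat.of X) _).injective (eq_of_heq h)

lemma exists_toChain_eq_iff (n : ℕ) {c : Chain X} :
    (∃ x, toChain n x = c) ↔ c ∈ on (deg X (n + 1)) := by
  have h := Finsupp.lmapDomain_supported ℚ ℚ
    (fun s => (⟨n + 1, toSingularSimplex n s⟩ : SingularSimplex X)) Set.univ
  have e : (fun s => (⟨n + 1, toSingularSimplex n s⟩ : SingularSimplex X)) '' Set.univ =
      deg X (n + 1) := by
    ext ⟨k, σ⟩
    constructor
    · rintro ⟨s, -, h⟩
      obtain ⟨rfl, -⟩ := Sigma.mk.inj_iff.1 h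
      exact Nat.cast_succ n
    · intro hk
      obtain rfl : k = n + 1 := by have : (k : ℤ) = n + 1 := hk; omega
      exact ⟨(TopCat.toSSetObjEquiv (TopCat.of X) _).symm σ, trivial, by
        simp [toSingularSimplex]⟩
  rw [e, Finsupp.supported_univ] at h
  change _ ↔ c ∈ Finsupp.supported ℚ ℚ _
  rw [← h, Submodule.map_top]
  rfl

lemma objD_apply (S : SimplicialObject (ModuleCat ℚ)) (n : ℕ) (x : S _⦋n + 1⦌) :
    (AlgebraicTopology.AlternatingFaceMapComplex.objD S n).hom x =
      ∑ i : Fin (n + 2), (-1 : ℤ) ^ (i : ℕ) • (S.δ i).hom x := by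
  rw [AlgebraicTopology.AlternatingFaceMapComplex.objD, ModuleCat.hom_sum, LinearMap.sum_apply]
  rfl

lemma toSingularSimplex_δ (n : ℕ) (s : TopCat.toSSet.obj (TopCat.of X) _⦋n + 1⦌)
    (i : Fin (n + 2)) :
    toSingularSimplex n ((TopCat.toSSet.obj (TopCat.of X)).δ i s) =
      (toSingularSimplex (n + 1) s).comp (affineMap fun j => vert (i.succAbove j)) := by
  ext z
  refine (TopCat.toSSetObjEquiv_δ_apply s i z).trans ?_
  refine congrArg (toSingularSimplex (n + 1) s) (Subtype.ext (funext fun k => ?_))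
  rw [affineMap_coe]
  refine (FunOnFinite.linearMap_apply_apply ℝ ℝ i.succAbove _ k).trans ?_
  rw [Finset.sum_filter, Finset.sum_apply]
  refine Finset.sum_congr rfl fun j _ => ?_
  by_cases h : i.succAbove j = k
  · subst h
    simp [vert]
    rfl
  · simp [vert, h, Ne.symm h]

lemma d_toChain (n : ℕ) (x : (singularComplex X).X (n + 1)) :
    d (toChain (n + 1) x) = toChain n ((singularComplex X).d (n + 1) n x) := by
  have : d ∘ₗ toChain (n + 1) = toChain n ∘ₗ ((singularComplex X).d (n + 1) n).hom := by
    refine Finsupp.lhom_ext' fun s => LinearMap.ext_ring ?_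
    change d (toChain (n + 1) (ModuleCat.freeMk s)) =
      toChain n (((singularComplex X).d (n + 1) n).hom (ModuleCat.freeMk s))
    rw [AlgebraicTopology.alternatingFaceMapComplex_obj_d]
    refine Eq.trans ?_ (congrArg (toChain n) (objD_apply
      (((SimplicialObject.whiskering _ _).obj (ModuleCat.free ℚ)).obj
        (TopCat.toSSet.obj (TopCat.of X))) n (ModuleCat.freeMk s))).symm
    refine Eq.trans ?_ (map_sum (toChain n) _ _).symm
    rw [toChain_freeMk, d_of, bdry]
    refine Finset.sum_congr rfl fun i _ => ?_
    refine Eq.trans ?_ (map_zsmul (toChain n) _ _).symm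
    have e : ((((SimplicialObject.whiskering _ _).obj (ModuleCat.free ℚ)).obj
        (TopCat.toSSet.obj (TopCat.of X))).δ i).hom (ModuleCat.freeMk s) =
        ModuleCat.freeMk ((TopCat.toSSet.obj (TopCat.of X)).δ i s) :=
      ModuleCat.free_map_apply _ _
    rw [← Int.cast_smul_eq_zsmul ℚ]
    push_cast
    refine congrArg _ (Eq.trans ?_ (congrArg (toChain n) e).symm)
    rw [toChain_freeMk, toSingularSimplex_δ]
  exact LinearMap.congr_fun this x

lemma simpIn_empty : simpIn (∅ : Set X) = deg X 0 := by
  ext ⟨n, σ⟩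
  refine ⟨fun h => by simpa [deg] using Acyc.eq_zero_of_mem_simpIn_empty h, fun h t => ?_⟩
  obtain rfl : n = 0 := by simpa [deg] using h
  simpa using t.2.2

lemma eq_zero_of_mem_deg {c : Chain X} {n m : ℤ} (hnm : n ≠ m) (hn : c ∈ on (deg X n))
    (hm : c ∈ on (deg X m)) : c = 0 := by
  rw [← component_of_mem_deg hn, component_of_mem_deg_ne hnm.symm hm]

lemma subsingleton_ratHomology_iff (n : ℕ) :
    Subsingleton (ratHomology X n) ↔ Acyc (n + 1) (simpIn ∅) (simpIn (Set.univ : Set X)) := by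
  have h1 : Subsingleton (ratHomology X n) ↔
      ∀ x, ((singularComplex X).sc n).g x = 0 → ∃ y, (singularComplex X).d (n + 1) n y = x := by
    rw [← ModuleCat.isZero_iff_subsingleton, ratHomology,
      ← HomologicalComplex.exactAt_iff_isZero_homology,
      HomologicalComplex.exactAt_iff' _ (n + 1) n _ (by simp) rfl,
      ShortComplex.moduleCat_exact_iff]
    rfl
  have h2 (x : (singularComplex X).X n) :
      ((singularComplex X).sc n).g x = 0 ↔ d (toChain n x) ∈ on (simpIn ∅) := by
    cases n with
    | zero =>
      have : (singularComplex X).d 0 ((ComplexShape.down ℕ).next 0) = 0 := by simp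
      refine iff_of_true ?_ ?_
      · change (singularComplex X).d 0 ((ComplexShape.down ℕ).next 0) x = 0
        rw [this]; rfl
      · rw [simpIn_empty]
        exact d_mem_deg ((exists_toChain_eq_iff 0).1 ⟨x, rfl⟩)
    | succ m =>
      rw [d_toChain, simpIn_empty]
      have : ((singularComplex X).sc (m + 1)).g x = 0 ↔ (singularComplex X).d (m + 1) m x = 0 := by
        have hm : (ComplexShape.down ℕ).next (m + 1) = m := by simp
        change (singularComplex X).d (m + 1) ((ComplexShape.down ℕ).next (m + 1)) x = 0 ↔ _
        rw [hm]
      rw [this, ← map_eq_zero_iff (toChain m) (toChain_injective m)]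
      refine ⟨fun h => h ▸ Submodule.zero_mem _, fun h => ?_⟩
      exact eq_zero_of_mem_deg (by omega) ((exists_toChain_eq_iff m).1 ⟨_, rfl⟩) h
  rw [h1]
  constructor
  · intro H c hc hdc
    obtain ⟨x, rfl⟩ := (exists_toChain_eq_iff n).2 (mem_on_inter.1 hc).2
    obtain ⟨y, rfl⟩ := H x ((h2 x).2 hdc)
    refine ⟨toChain (n + 1) y, ?_, ?_⟩
    · rw [simpIn_univ, Set.univ_inter]
      have := (exists_toChain_eq_iff (n + 1)).1 ⟨y, rfl⟩
      exact_mod_cast this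
    · rw [d_toChain, sub_self]
      exact Submodule.zero_mem _
  · intro H x hx
    have hxn := (exists_toChain_eq_iff n).1 ⟨x, rfl⟩
    obtain ⟨w, hw, hxw⟩ := H (toChain n x)
      (by rw [simpIn_univ, Set.univ_inter]; exact hxn) ((h2 x).1 hx)
    have hw' := (mem_on_inter.1 hw).2
    obtain ⟨y, rfl⟩ := (exists_toChain_eq_iff (n + 1)).2 (by exact_mod_cast hw')
    refine ⟨y, toChain_injective n ?_⟩
    rw [simpIn_empty] at hxw
    rw [← d_toChain]
    exact (sub_eq_zero.1 (eq_zero_of_mem_deg (n := n + 1) (by omega)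
      (Submodule.sub_mem _ hxn (d_mem_deg hw')) hxw)).symm

end

end SingularChains

/-- **Lemma 5.7**: with `L = R = ⨁_{n=1}^N ℂ^{d_n}` and `ℂ*` acting diagonally with weight
`−n` on the `n`-th summand of `L` and weight `n` on the `n`-th summand of `R`, the orbit
space of `U = {(x,y) ∈ L ⊕ R : x ≠ 0, y ≠ 0}` has nontrivial rational homology in all
dimensions `0, 2, …, 2M, 2M+1, 2M+3, …, 4M+1`, where `M = dim_ℂ L − 1`; in particular it
has the rational homology of no sphere unless `M = 0`. -/
theorem punctured_local_model_homology (N : ℕ) (hN : 1 ≤ N) (d : Fin N → ℕ) (hd : ∃ n, d n ≠ 0) :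
    (∀ j : ℕ,
      ((Even j ∧ j ≤ 2 * (Module.finrank ℂ (∀ n : Fin N, Fin (d n) → ℂ) - 1)) ∨
        (Odd j ∧ 2 * (Module.finrank ℂ (∀ n : Fin N, Fin (d n) → ℂ) - 1) + 1 ≤ j ∧
          j ≤ 4 * (Module.finrank ℂ (∀ n : Fin N, Fin (d n) → ℂ) - 1) + 1)) →
      Nontrivial (ratHomology
        (Quotient (Setoid.comap
          (Subtype.val :
            {p : (∀ n : Fin N, Fin (d n) → ℂ) × (∀ n : Fin N, Fin (d n) → ℂ) //
              p.1 ≠ 0 ∧ p.2 ≠ 0} →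
            (∀ n : Fin N, Fin (d n) → ℂ) × (∀ n : Fin N, Fin (d n) → ℂ))
          (actionSetoid (diagWeightHom N d)))) j))
    ∧ (Module.finrank ℂ (∀ n : Fin N, Fin (d n) → ℂ) - 1 ≠ 0 →
      ∀ m : ℤ, ¬ ∀ j : ℕ,
        Nonempty ((ratHomology
          (Quotient (Setoid.comap
            (Subtype.val :
              {p : (∀ n : Fin N, Fin (d n) → ℂ) × (∀ n : Fin N, Fin (d n) → ℂ) //
                p.1 ≠ 0 ∧ p.2 ≠ 0} →
              (∀ n : Fin N, Fin (d n) → ℂ) × (∀ n : Fin N, Fin (d n) → ℂ))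
            (actionSetoid (diagWeightHom N d)))) j) ≃ₗ[ℚ]
          (ratHomology (SphereSpace m) j))) := by
  set D := Module.finrank ℂ (∀ n : Fin N, Fin (d n) → ℂ) with hD
  have hpos : 1 ≤ D := by
    obtain ⟨n, hn⟩ := hd
    have : Nonempty (SingularChains.Coord N d) := ⟨⟨n, ⟨0, Nat.pos_of_ne_zero hn⟩⟩⟩
    exact (Fintype.card_pos.trans_eq SingularChains.finrank_rep.symm)
  have key : ∀ j : ℕ, ((Even j ∧ j ≤ 2 * (D - 1)) ∨
      (Odd j ∧ 2 * (D - 1) + 1 ≤ j ∧ j ≤ 4 * (D - 1) + 1)) →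
      Nontrivial (ratHomology (Quotient (SingularChains.orbitSetoid N d)) j) := by
    intro j hj
    rw [← not_subsingleton_iff_nontrivial, SingularChains.subsingleton_ratHomology_iff]
    refine SingularChains.not_acyc_orbitSpace hd ?_
    change ((j : ℤ) + 1) % 2 = 1 ∧ 1 ≤ (j : ℤ) + 1 ∧ (j : ℤ) + 1 ≤ 2 * (D : ℤ) - 1 ∨
      ((j : ℤ) + 1) % 2 = 0 ∧ 2 * (D : ℤ) ≤ (j : ℤ) + 1 ∧ (j : ℤ) + 1 ≤ 4 * (D : ℤ) - 2
    rw [Nat.even_iff, Nat.odd_iff] at hj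
    omega
  refine ⟨key, fun hM m H => ?_⟩
  obtain ⟨j, hj, hj0, hjm⟩ : ∃ j : ℕ, ((Even j ∧ j ≤ 2 * (D - 1)) ∨
      (Odd j ∧ 2 * (D - 1) + 1 ≤ j ∧ j ≤ 4 * (D - 1) + 1)) ∧ j ≠ 0 ∧ (j : ℤ) ≠ m := by
    by_cases h : m = 2
    · refine ⟨4 * (D - 1) + 1, Or.inr ⟨?_, by omega, le_rfl⟩, by omega, by omega⟩
      rw [Nat.odd_iff]; omega
    · exact ⟨2, Or.inl ⟨even_two, by omega⟩, two_ne_zero, fun h' => h (by omega)⟩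
  have : Subsingleton (ratHomology (SphereSpace m) j) :=
    (SingularChains.subsingleton_ratHomology_iff j).2
      (SingularChains.Acyc.sphereSpace (by omega) (by omega))
  obtain ⟨e⟩ := H j
  exact not_subsingleton_iff_nontrivial.2 (key j hj) e.toEquiv.subsingleton
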